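/- arXiv:math/0609175 — 3 statements merged into one kernel-verified Lean document; each statement's English description precedes it below -/
import Mathlib

section
/- Let c = 2√(π²/6). Then s(n) ∼ e^{(c/2)√n} / (2^{7/4}·3^{1/4}·n^{3/4}) as n → ∞; that is, s(n)·2^{7/4}·3^{1/4}·n^{3/4} / e^{(c/2)√n} → 1. -/
/-- `p n` is the number of partitions of `n`. -/
def p (n : ℕ) : ℕ := Fintype.card (Nat.Partition n)

/-- `t n` is the number of ordered pairs `(μ, ν)` of partitions with `|μ| + |ν| = n`;
equivalently `t n = ∑ p m * p (n - m)`. -/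
def t (n : ℕ) : ℕ := ∑ m ∈ Finset.range (n + 1), p m * p (n - m)

/-- `c = 2 √(π²/6)` is the Hardy–Ramanujan constant. -/
noncomputable def c : ℝ := 2 * Real.sqrt (Real.pi ^ 2 / 6)

/-- The multiset of parts of the conjugate partition: the `j`-th part of the conjugate of
`λ` is `λ´_j = #{i : λ_i ≥ j}`, for those `j ≥ 1` for which this is positive. -/
def conjParts {n : ℕ} (P : n.Partition) : Multiset ℕ :=
  (((Finset.Icc 1 n).val.map fun j => (P.parts.filter fun a => j ≤ a).card).filter
    fun m => 0 < m)

/-- `s n` is the number of self-conjugate partitions of `n`. -/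
def s (n : ℕ) : ℕ := Fintype.card {P : n.Partition // P.parts = conjParts P}

open Filter

open Topology

/-- The product `∏ (1 + q ^ (2k+1))`, the generating function of partitions into distinct odd
parts. -/
noncomputable def oddProd (q : ℂ) : ℂ := ∏' k : ℕ, (1 + q ^ (2 * k + 1))

lemma summable_pow_odd {r : ℝ} (h0 : 0 ≤ r) (h1 : r < 1) :
    Summable fun k : ℕ => r ^ (2 * k + 1) :=
  (summable_geometric_of_lt_one h0 h1).comp_injective
    (i := fun k : ℕ => 2 * k + 1) (fun a b h => by simpa using h)

lemma multipliable_oddProd {q : ℂ} (hq : ‖q‖ < 1) :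
    Multipliable fun k : ℕ => 1 + q ^ (2 * k + 1) :=
  multipliable_one_add_of_summable (by simpa using summable_pow_odd (norm_nonneg _) hq)

lemma multipliable_one_add_pow {q : ℂ} (hq : ‖q‖ < 1) :
    Multipliable fun n : ℕ => 1 + q ^ (n + 1) :=
  multipliable_one_add_of_summable
    (by simpa using (summable_nat_add_iff 1).mpr (summable_geometric_of_lt_one (norm_nonneg _) hq))

lemma tprod_one_add_pow_mul {q : ℂ} (hq : ‖q‖ < 1) :
    (∏' n : ℕ, (1 + q ^ (n + 1))) * ∏' n : ℕ, (1 - q ^ (n + 1)) =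
      ∏' n : ℕ, (1 - (q ^ 2) ^ (n + 1)) := by
  rw [← (multipliable_one_add_pow hq).tprod_mul (ModularForm.multipliable_one_sub_pow hq)]
  exact tprod_congr fun n => by ring

lemma norm_sq_lt_one {q : ℂ} (hq : ‖q‖ < 1) : ‖q ^ 2‖ < 1 := by
  simpa using pow_lt_one₀ (norm_nonneg _) hq two_ne_zero

lemma tprod_one_add_pow_eq {q : ℂ} (hq : ‖q‖ < 1) :
    ∏' n : ℕ, (1 + q ^ (n + 1)) = oddProd q * ∏' n : ℕ, (1 + (q ^ 2) ^ (n + 1)) := by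
  rw [← tprod_even_mul_odd (f := fun n : ℕ => 1 + q ^ (n + 1))]
  · exact congrArg _ (tprod_congr fun n => by ring)
  · exact multipliable_oddProd hq
  · exact (multipliable_one_add_pow (norm_sq_lt_one hq)).congr fun n => by ring

lemma oddProd_mul_eq {q : ℂ} (hq : ‖q‖ < 1) :
    oddProd q * ((∏' n : ℕ, (1 - q ^ (n + 1))) * ∏' n : ℕ, (1 - (q ^ 4) ^ (n + 1))) =
      (∏' n : ℕ, (1 - (q ^ 2) ^ (n + 1))) ^ 2 := by
  have h1 := tprod_one_add_pow_mul hq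
  have h2 := tprod_one_add_pow_mul (norm_sq_lt_one hq)
  rw [← pow_mul] at h2
  norm_num at h2
  rw [tprod_one_add_pow_eq hq] at h1
  rw [← h2]
  linear_combination (∏' n : ℕ, (1 - (q ^ 2) ^ (n + 1))) * h1

lemma oddProd_mul_eta {τ : ℂ} (hτ : 0 < τ.im) :
    Complex.exp (-(Real.pi * Complex.I * τ / 24)) *
      oddProd (Complex.exp (Real.pi * Complex.I * τ)) *
      (ModularForm.eta (τ / 2) * ModularForm.eta (2 * τ)) = ModularForm.eta τ ^ 2 := by
  have hq : ‖Complex.exp (Real.pi * Complex.I * τ)‖ < 1 := by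
    rw [Complex.norm_exp]
    simp [Real.pi_pos, hτ]
  have key := oddProd_mul_eq hq
  have h1 : Complex.exp (2 * Real.pi * Complex.I * (τ / 2)) =
      Complex.exp (Real.pi * Complex.I * τ) := by ring_nf
  have h2 : Complex.exp (2 * Real.pi * Complex.I * τ) =
      Complex.exp (Real.pi * Complex.I * τ) ^ 2 := by
    rw [← Complex.exp_nat_mul]; push_cast; ring_nf
  have h4 : Complex.exp (2 * Real.pi * Complex.I * (2 * τ)) =
      Complex.exp (Real.pi * Complex.I * τ) ^ 4 := by
    rw [← Complex.exp_nat_mul]; push_cast; ring_nf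
  simp only [ModularForm.eta, ModularForm.eta_q_eq_pow, h1, h2, h4, Function.Periodic.qParam]
  rw [mul_pow, ← key]
  have : Complex.exp (2 * Real.pi * Complex.I * τ / (24 : ℝ)) ^ 2 =
      Complex.exp (-(Real.pi * Complex.I * τ / 24)) *
        (Complex.exp (2 * Real.pi * Complex.I * (τ / 2) / (24 : ℝ)) *
        Complex.exp (2 * Real.pi * Complex.I * (2 * τ) / (24 : ℝ))) := by
    rw [← Complex.exp_add, ← Complex.exp_add, ← Complex.exp_nat_mul]; push_cast; ring_nf
  rw [this]
  ring

lemma eta_neg_inv {τ : ℂ} (hτ : 0 < τ.im) :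
    ModularForm.eta (-1 / τ) = (Complex.sqrt Complex.I)⁻¹ * (Complex.sqrt τ * ModularForm.eta τ) :=
  ModularForm.eta_comp_eq_csqrt_I_inv hτ

lemma sqrt_two_mul_mul_sqrt_half {τ : ℂ} (hτ : τ ≠ 0) :
    Complex.sqrt (2 * τ) * Complex.sqrt (τ / 2) = τ := by
  have h1 : Complex.log (2 * τ) = (Real.log 2 : ℝ) + Complex.log τ := by
    exact_mod_cast Complex.log_ofReal_mul (r := 2) two_pos hτ
  have h2 : Complex.log (τ / 2) = (Real.log (1 / 2) : ℝ) + Complex.log τ := by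
    rw [← Complex.log_ofReal_mul (r := 1 / 2) (by norm_num) hτ]
    push_cast
    ring_nf
  unfold Complex.sqrt
  rw [Complex.cpow_def_of_ne_zero (by simpa), Complex.cpow_def_of_ne_zero (by simpa), h1, h2,
    ← Complex.exp_add, one_div, Real.log_inv]
  push_cast
  ring_nf
  exact Complex.exp_log hτ

lemma sqrt_mul_self_complex {τ : ℂ} (hτ : τ ≠ 0) : Complex.sqrt τ * Complex.sqrt τ = τ := by
  unfold Complex.sqrt
  rw [← Complex.cpow_add _ _ hτ]
  norm_num

lemma weber_transform {τ : ℂ} (hτ : 0 < τ.im) :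
    Complex.exp (-(Real.pi * Complex.I * (-1 / τ) / 24)) *
        oddProd (Complex.exp (Real.pi * Complex.I * (-1 / τ))) =
      Complex.exp (-(Real.pi * Complex.I * τ / 24)) *
        oddProd (Complex.exp (Real.pi * Complex.I * τ)) := by
  have h0 : τ ≠ 0 := by rintro rfl; simp at hτ
  have h2τ : 0 < (2 * τ).im := by simpa using hτ
  have hτ2 : 0 < (τ / 2).im := by simpa using hτ
  have hinv : 0 < (-1 / τ).im := by
    rw [neg_div, Complex.neg_im, one_div, Complex.inv_im, neg_div, neg_neg]
    exact div_pos hτ (Complex.normSq_pos.2 h0)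
  have hI := sqrt_mul_self_complex Complex.I_ne_zero
  have hs := sqrt_mul_self_complex h0
  have hp := sqrt_two_mul_mul_sqrt_half h0
  have key := oddProd_mul_eta hτ
  have key' := oddProd_mul_eta hinv
  rw [show -1 / τ / 2 = -1 / (2 * τ) by field_simp, show 2 * (-1 / τ) = -1 / (τ / 2) by field_simp,
    eta_neg_inv hτ, eta_neg_inv h2τ, eta_neg_inv hτ2] at key'
  have e1 : ModularForm.eta (τ / 2) ≠ 0 := ModularForm.eta_ne_zero hτ2
  have e2 : ModularForm.eta (2 * τ) ≠ 0 := ModularForm.eta_ne_zero h2τ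
  have hI0 : (Complex.sqrt Complex.I)⁻¹ ≠ 0 := by
    intro h
    rw [inv_eq_zero] at h
    simp [h] at hI
    exact Complex.I_ne_zero hI.symm
  generalize (Complex.sqrt Complex.I)⁻¹ = u at *
  have hne : u ^ 2 * τ * (ModularForm.eta (τ / 2) * ModularForm.eta (2 * τ)) ≠ 0 := by
    positivity
  refine mul_right_cancel₀ hne ?_
  generalize Complex.exp (-(Real.pi * Complex.I * (-1 / τ) / 24)) *
        oddProd (Complex.exp (Real.pi * Complex.I * (-1 / τ))) = X at *
  generalize Complex.exp (-(Real.pi * Complex.I * τ / 24)) *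
        oddProd (Complex.exp (Real.pi * Complex.I * τ)) = Y at *
  linear_combination key' - (X * u ^ 2 * (ModularForm.eta (τ / 2) * ModularForm.eta (2 * τ))) * hp -
    u ^ 2 * τ * key + u ^ 2 * ModularForm.eta τ ^ 2 * hs

/-- The modular transformation of `oddProd`. -/
lemma oddProd_exp_neg {z : ℂ} (hz : 0 < z.re) :
    oddProd (Complex.exp (-z)) =
      Complex.exp (Real.pi ^ 2 / (24 * z) - z / 24) *
        oddProd (Complex.exp (-(Real.pi ^ 2 / z))) := by
  have h0 : z ≠ 0 := by rintro rfl; simp at hz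
  have hpi : (Real.pi : ℂ) ≠ 0 := by exact_mod_cast Real.pi_ne_zero
  have key := weber_transform (τ := Complex.I * z / Real.pi) (by
    rw [Complex.div_ofReal_im]; simpa using div_pos hz Real.pi_pos)
  have i1 : Real.pi * Complex.I * (Complex.I * z / Real.pi) = -z := by
    field_simp; simp
  have i2 : Real.pi * Complex.I * (-1 / (Complex.I * z / Real.pi)) = -(Real.pi ^ 2 / z) := by
    field_simp
  rw [i1, i2] at key
  have : Complex.exp (Real.pi ^ 2 / (24 * z) - z / 24) =
    Complex.exp (-(z / 24)) * Complex.exp (-(-(Real.pi ^ 2 / z) / 24)) := by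
    rw [← Complex.exp_add]; congr 1; field_simp; ring
  rw [this, mul_assoc, key, ← mul_assoc, ← Complex.exp_add]
  ring_nf
  simp

lemma hasSum_pow_odd {q : ℂ} (hq : ‖q‖ < 1) :
    HasSum (fun k : ℕ => q ^ (2 * k + 1)) (q / (1 - q ^ 2)) := by
  have := (hasSum_geometric_of_norm_lt_one (norm_sq_lt_one hq)).mul_left q
  simpa only [← pow_mul, ← pow_succ', div_eq_mul_inv] using this

lemma hasSum_pow_odd_real {r : ℝ} (h0 : 0 ≤ r) (h1 : r < 1) :
    HasSum (fun k : ℕ => r ^ (2 * k + 1)) (r / (1 - r ^ 2)) := by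
  have := (hasSum_geometric_of_lt_one (sq_nonneg r) (pow_lt_one₀ h0 h1 two_ne_zero)).mul_left r
  simpa only [← pow_mul, ← pow_succ', div_eq_mul_inv] using this

lemma tendsto_oddProd {q : ℂ} (hq : ‖q‖ < 1) :
    Tendsto (fun N => ∏ k ∈ Finset.range N, (1 + q ^ (2 * k + 1))) atTop (𝓝 (oddProd q)) :=
  (multipliable_oddProd hq).hasProd.tendsto_prod_nat

lemma norm_prod_odd_sub_one_le {q : ℂ} (hq : ‖q‖ < 1) (N : ℕ) :
    ‖∏ k ∈ Finset.range N, (1 + q ^ (2 * k + 1)) - 1‖ ≤ Real.exp (‖q‖ / (1 - ‖q‖ ^ 2)) - 1 := by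
  refine (Finset.norm_prod_one_add_sub_one_le _ _).trans ?_
  gcongr
  simp only [norm_pow]
  exact sum_le_hasSum _ (fun _ _ => by positivity) (hasSum_pow_odd_real (norm_nonneg _) hq)

lemma norm_prod_odd_le {q : ℂ} (hq : ‖q‖ < 1) (N : ℕ) :
    ‖∏ k ∈ Finset.range N, (1 + q ^ (2 * k + 1))‖ ≤ Real.exp (‖q‖ / (1 - ‖q‖ ^ 2)) := by
  have h1 := norm_prod_odd_sub_one_le hq N
  have h2 := norm_le_norm_sub_add (∏ k ∈ Finset.range N, (1 + q ^ (2 * k + 1))) 1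
  rw [norm_one] at h2
  linarith

lemma norm_oddProd_sub_one_le {q : ℂ} (hq : ‖q‖ < 1) :
    ‖oddProd q - 1‖ ≤ Real.exp (‖q‖ / (1 - ‖q‖ ^ 2)) - 1 :=
  le_of_tendsto ((tendsto_oddProd hq).sub_const 1).norm
    (Eventually.of_forall fun N => norm_prod_odd_sub_one_le hq N)

lemma norm_oddProd_le_exp_one {q : ℂ} (hq : ‖q‖ ≤ 1 / 2) : ‖oddProd q‖ ≤ Real.exp 1 := by
  refine (le_of_tendsto (tendsto_oddProd (by linarith)).norm
    (Eventually.of_forall fun N => norm_prod_odd_le (by linarith) N)).trans ?_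
  gcongr
  have := norm_nonneg q
  rw [div_le_one (by nlinarith)]
  nlinarith

lemma tendsto_oddProd_zero : Tendsto oddProd (𝓝 0) (𝓝 1) := by
  rw [tendsto_iff_norm_sub_tendsto_zero]
  have hlim : Tendsto (fun q : ℂ => Real.exp (‖q‖ / (1 - ‖q‖ ^ 2)) - 1) (𝓝 0) (𝓝 0) := by
    have : ContinuousAt (fun q : ℂ => Real.exp (‖q‖ / (1 - ‖q‖ ^ 2)) - 1) 0 := by
      have h : (1 : ℝ) - ‖(0 : ℂ)‖ ^ 2 ≠ 0 := by simp
      fun_prop (disch := exact h)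
    simpa [ContinuousAt] using this
  refine squeeze_zero' (Eventually.of_forall fun _ => norm_nonneg _) ?_ hlim
  filter_upwards [Metric.ball_mem_nhds (0 : ℂ) one_pos] with q hq
  exact norm_oddProd_sub_one_le (by simpa using hq)

lemma norm_one_add_le {x : ℂ} (hx : ‖x‖ ≤ 1) :
    ‖1 + x‖ ≤ (1 + ‖x‖) * Real.exp (-((‖x‖ - x.re) / 4)) := by
  have h0 := norm_nonneg x
  have hd : x.re ≤ ‖x‖ := Complex.re_le_norm x
  refine le_of_sq_le_sq ?_ (by positivity)
  have hsq : ‖1 + x‖ ^ 2 = 1 + 2 * x.re + ‖x‖ ^ 2 := by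
    rw [← Complex.normSq_eq_norm_sq, ← Complex.normSq_eq_norm_sq, Complex.normSq_apply,
      Complex.normSq_apply]
    simp
    ring
  have he : Real.exp (-((‖x‖ - x.re) / 4)) ^ 2 = Real.exp (-((‖x‖ - x.re) / 2)) := by
    rw [← Real.exp_nat_mul]; push_cast; ring_nf
  have hexp := Real.add_one_le_exp (-((‖x‖ - x.re) / 2))
  rw [mul_pow, he, hsq]
  calc 1 + 2 * x.re + ‖x‖ ^ 2 ≤ (1 + ‖x‖) ^ 2 * (-((‖x‖ - x.re) / 2) + 1) := by
        nlinarith [mul_nonneg (sub_nonneg.2 hd) (show 0 ≤ 4 - (1 + ‖x‖) ^ 2 by nlinarith)]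
    _ ≤ _ := by gcongr

lemma norm_oddProd_le_of_re {q : ℂ} (hq : ‖q‖ < 1) :
    ‖oddProd q‖ ≤ ‖oddProd (‖q‖ : ℂ)‖ *
      Real.exp (-((‖q‖ / (1 - ‖q‖ ^ 2) - (q / (1 - q ^ 2)).re) / 4)) := by
  have hq' : ‖(‖q‖ : ℂ)‖ < 1 := by simpa using hq
  have hs : HasSum (fun k : ℕ => -((‖q‖ ^ (2 * k + 1) - (q ^ (2 * k + 1)).re) / 4))
      (-((‖q‖ / (1 - ‖q‖ ^ 2) - (q / (1 - q ^ 2)).re) / 4)) :=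
    (((hasSum_pow_odd_real (norm_nonneg _) hq).sub
      (Complex.hasSum_re (hasSum_pow_odd hq))).div_const 4).neg
  refine le_of_tendsto_of_tendsto' (tendsto_oddProd hq).norm
    ((tendsto_oddProd hq').norm.mul (hs.tendsto_sum_nat.rexp)) fun N => ?_
  rw [norm_prod, norm_prod, Real.exp_sum, ← Finset.prod_mul_distrib]
  refine Finset.prod_le_prod (fun _ _ => norm_nonneg _) fun k _ => ?_
  have h1 : ‖q ^ (2 * k + 1)‖ ≤ 1 := by
    rw [norm_pow]; exact pow_le_one₀ (norm_nonneg _) hq.le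
  have h2 : ‖1 + (‖q‖ : ℂ) ^ (2 * k + 1)‖ = 1 + ‖q‖ ^ (2 * k + 1) := by
    rw [← Complex.ofReal_pow, ← Complex.ofReal_one, ← Complex.ofReal_add, Complex.norm_real,
      Real.norm_of_nonneg (by positivity)]
  rw [h2]
  simpa only [norm_pow] using norm_one_add_le h1

lemma re_odd_sum_eq (r θ : ℝ) :
    ((r * Complex.exp (θ * Complex.I)) / (1 - (r * Complex.exp (θ * Complex.I)) ^ 2)).re =
      r * (1 - r ^ 2) * Real.cos θ / ((1 - r ^ 2) ^ 2 + 4 * r ^ 2 * Real.sin θ ^ 2) := by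
  have he : Complex.exp (θ * Complex.I) = ⟨Real.cos θ, Real.sin θ⟩ := by
    apply Complex.ext
    · rw [Complex.exp_ofReal_mul_I_re]
    · rw [Complex.exp_ofReal_mul_I_im]
  have h1 := Real.sin_sq_add_cos_sq θ
  rw [he, Complex.div_re, ← add_div]
  generalize Real.cos θ = x at *
  generalize Real.sin θ = y at *
  have e1 : y ^ 2 = 1 - x ^ 2 := by linarith
  congr 1
  · simp [pow_two]
    linear_combination (-r ^ 3 * x) * e1
  · simp [Complex.normSq_apply, pow_two]
    linear_combination (-2 * r ^ 2 + r ^ 4 * (x ^ 2 + y ^ 2 + 1)) * h1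

lemma odd_sum_gap {t θ : ℝ} (ht : 0 < t) (ht2 : t ≤ 1 / 2) (h1 : t ≤ |θ|) (h2 : |θ| ≤ Real.pi) :
    1 / (44 * t) ≤ Real.exp (-t) / (1 - Real.exp (-t) ^ 2) -
      Real.exp (-t) * (1 - Real.exp (-t) ^ 2) * Real.cos θ /
        ((1 - Real.exp (-t) ^ 2) ^ 2 + 4 * Real.exp (-t) ^ 2 * Real.sin θ ^ 2) := by
  have hr1 : Real.exp (-t) < 1 := by simpa using ht
  have hr2 : 1 / 2 ≤ Real.exp (-t) := by linarith [Real.add_one_le_exp (-t)]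
  have hd2 : 1 - Real.exp (-t) ^ 2 ≤ 2 * t := by
    have : Real.exp (-t) ^ 2 = Real.exp (-(2 * t)) := by
      rw [← Real.exp_nat_mul]; push_cast; ring_nf
    rw [this]
    linarith [Real.add_one_le_exp (-(2 * t))]
  generalize Real.exp (-t) = r at *
  have hd : 0 < 1 - r ^ 2 := by nlinarith
  generalize hD : 1 - r ^ 2 = D at *
  have key : D ^ 2 * Real.cos θ / (D ^ 2 + 4 * r ^ 2 * Real.sin θ ^ 2) ≤ 10 / 11 := by
    have hpos : 0 < D ^ 2 + 4 * r ^ 2 * Real.sin θ ^ 2 := by positivity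
    rw [div_le_div_iff₀ hpos (by norm_num)]
    rcases le_or_gt (Real.cos θ) 0 with hc | hc
    · have : D ^ 2 * Real.cos θ ≤ 0 := mul_nonpos_of_nonneg_of_nonpos (by positivity) hc
      nlinarith
    · have hθ : |θ| ≤ Real.pi / 2 := by
        by_contra h
        push Not at h
        have := Real.cos_nonpos_of_pi_div_two_le_of_le h.le (by linarith [Real.pi_pos])
        rw [Real.cos_abs] at this
        linarith
      have hs := Real.mul_le_sin (abs_nonneg θ) hθ
      have hs2 : Real.sin |θ| ^ 2 = Real.sin θ ^ 2 := by
        rcases abs_choice θ with h | h <;> simp [h]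
      have hpi : Real.pi ^ 2 < 10 := by nlinarith [Real.pi_lt_d2, Real.pi_pos]
      have hs3 : (2 / Real.pi * t) ^ 2 ≤ Real.sin θ ^ 2 := by
        rw [← hs2]
        have := Real.pi_pos
        gcongr
        exact le_trans (by gcongr) hs
      have hs4 : 4 / 10 * t ^ 2 ≤ (2 / Real.pi * t) ^ 2 := by
        rw [mul_pow, div_pow]
        have := Real.pi_pos
        gcongr
        norm_num
      have hc1 := Real.cos_le_one θ
      have h5 : D ^ 2 ≤ (2 * t) ^ 2 := by gcongr
      have h6 : D ^ 2 / 10 ≤ 4 * r ^ 2 * Real.sin θ ^ 2 :=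
        le_trans (by linarith) (le_mul_of_one_le_left (sq_nonneg _) (by nlinarith : 1 ≤ 4 * r ^ 2))
      nlinarith
  have e : r / D - r * D * Real.cos θ / (D ^ 2 + 4 * r ^ 2 * Real.sin θ ^ 2) =
      r / D * (1 - D ^ 2 * Real.cos θ / (D ^ 2 + 4 * r ^ 2 * Real.sin θ ^ 2)) := by
    field_simp
  rw [e]
  calc 1 / (44 * t) = 1 / 2 / (2 * t) * (1 / 11) := by field_simp; norm_num
    _ ≤ _ := by
      gcongr
      linarith

lemma exp_neg_le_half {u : ℝ} (hu : 1 ≤ u) : Real.exp (-u) ≤ 1 / 2 := by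
  rw [Real.exp_neg, one_div]
  gcongr
  linarith [Real.add_one_le_exp u]

lemma norm_oddProd_minor_le {t θ : ℝ} (ht : 0 < t) (ht2 : t ≤ 1 / 2) (h1 : t ≤ |θ|)
    (h2 : |θ| ≤ Real.pi) :
    ‖oddProd (Complex.exp (-(t - θ * Complex.I)))‖ ≤
      Real.exp 1 * Real.exp (Real.pi ^ 2 / (24 * t) - 1 / (176 * t)) := by
  have hq : Complex.exp (-(t - θ * Complex.I)) =
      (Real.exp (-t) : ℝ) * Complex.exp (θ * Complex.I) := by
    rw [Complex.ofReal_exp, ← Complex.exp_add]; push_cast; ring_nf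
  have hn : ‖Complex.exp (-(t - θ * Complex.I))‖ = Real.exp (-t) := by
    rw [Complex.norm_exp]; simp
  have hlt : ‖Complex.exp (-(t - θ * Complex.I))‖ < 1 := by rw [hn]; simpa using ht
  have hmain : ‖oddProd ((Real.exp (-t) : ℝ) : ℂ)‖ ≤
      Real.exp (Real.pi ^ 2 / (24 * t)) * Real.exp 1 := by
    have := oddProd_exp_neg (z := (t : ℂ)) (by simpa using ht)
    rw [show ((Real.exp (-t) : ℝ) : ℂ) = Complex.exp (-(t : ℂ)) by push_cast; rfl, this, norm_mul]
    have e1 : ((Real.pi : ℂ) ^ 2 / (24 * t) - t / 24) =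
      ((Real.pi ^ 2 / (24 * t) - t / 24 : ℝ) : ℂ) := by push_cast; rfl
    have e2 : -((Real.pi : ℂ) ^ 2 / t) = ((-(Real.pi ^ 2 / t) : ℝ) : ℂ) := by push_cast; rfl
    gcongr
    · rw [e1, Complex.norm_exp, Complex.ofReal_re]
      gcongr
      linarith
    · apply norm_oddProd_le_exp_one
      rw [e2, Complex.norm_exp, Complex.ofReal_re]
      apply exp_neg_le_half
      rw [le_div_iff₀ ht]
      nlinarith [Real.pi_gt_three]
  have hb := norm_oddProd_le_of_re hlt
  rw [hn] at hb
  refine hb.trans ?_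
  have hg := odd_sum_gap ht ht2 h1 h2
  rw [hq, re_odd_sum_eq]
  calc _ ≤ Real.exp (Real.pi ^ 2 / (24 * t)) * Real.exp 1 * Real.exp (-(1 / (44 * t) / 4)) := by
        gcongr
    _ = _ := by
        rw [mul_comm (Real.exp _) (Real.exp 1), mul_assoc, ← Real.exp_add]
        congr 2
        field_simp
        ring

namespace YoungDiagram

lemma sum_rowLens (μ : YoungDiagram) : μ.rowLens.sum = μ.card := by
  have hmaps : ∀ c ∈ μ.cells, c.1 ∈ Finset.range (μ.colLen 0) := by
    rintro ⟨i, j⟩ hc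
    rw [Finset.mem_range, ← mem_iff_lt_colLen]
    exact μ.up_left_mem le_rfl (Nat.zero_le j) hc
  rw [YoungDiagram.card, Finset.card_eq_sum_card_fiberwise hmaps, rowLens]
  have h : ∀ i, μ.rowLen i = (μ.cells.filter fun c => c.1 = i).card := fun i => μ.rowLen_eq_card
  simp only [← h]
  rfl

lemma rowLens_injective : Function.Injective rowLens := fun _ _ h =>
  equivListRowLens.injective (Subtype.ext h)

lemma coe_rowLens_inj {μ ν : YoungDiagram} :
    (μ.rowLens : Multiset ℕ) = ν.rowLens ↔ μ = ν := by
  refine ⟨fun h => rowLens_injective ?_, fun h => h ▸ rfl⟩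
  exact (Multiset.coe_eq_coe.1 h).eq_of_sortedGE μ.rowLens_sorted ν.rowLens_sorted

lemma rowLen_le_card (μ : YoungDiagram) (i : ℕ) : μ.rowLen i ≤ μ.card := by
  rw [rowLen_eq_card]
  exact Finset.card_le_card (Finset.filter_subset _ _)

/-- The partition whose parts are the row lengths of a Young diagram. -/
def toPartition {n : ℕ} (μ : YoungDiagram) (hμ : μ.card = n) : n.Partition where
  parts := μ.rowLens
  parts_pos h := μ.pos_of_mem_rowLens _ h
  parts_sum := by rw [Multiset.sum_coe, sum_rowLens, hμ]

lemma card_filter_rowLens (μ : YoungDiagram) (j : ℕ) :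
    ((μ.rowLens : Multiset ℕ).filter fun a => j + 1 ≤ a).card = μ.colLen j := by
  have : (μ.rowLens : Multiset ℕ) = (Multiset.range (μ.colLen 0)).map μ.rowLen := rfl
  rw [this, Multiset.filter_map, Multiset.card_map]
  have h : (Multiset.range (μ.colLen 0)).filter ((fun a => j + 1 ≤ a) ∘ μ.rowLen) =
      Multiset.range (μ.colLen j) := by
    change ((Finset.range (μ.colLen 0)).filter ((fun a => j + 1 ≤ a) ∘ μ.rowLen)).val =
      (Finset.range (μ.colLen j)).val
    congr 1
    ext i
    simp only [Finset.mem_filter, Finset.mem_range, Function.comp, Nat.succ_le_iff,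
      ← mem_iff_lt_rowLen, ← mem_iff_lt_colLen]
    exact ⟨fun h => h.2, fun h => ⟨μ.up_left_mem le_rfl (Nat.zero_le j) h, h⟩⟩
  rw [h, Multiset.card_range]

lemma conjParts_toPartition {n : ℕ} (μ : YoungDiagram) (hμ : μ.card = n) :
    conjParts (μ.toPartition hμ) = μ.transpose.rowLens := by
  have h1 : (Finset.Icc 1 n).val = (Multiset.range n).map (· + 1) := by
    have : Finset.Icc 1 n = (Finset.range n).map (addRightEmbedding 1) := by
      rw [Finset.range_eq_Ico, Finset.map_add_right_Ico]
      ext x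
      simp only [Finset.mem_Icc, Finset.mem_Ico]
      omega
    rw [this]; rfl
  unfold conjParts
  rw [h1, Multiset.map_map]
  have h2 : (Multiset.range n).map ((fun j => ((μ.toPartition hμ).parts.filter
      fun a => j ≤ a).card) ∘ (· + 1)) = (Multiset.range n).map μ.colLen :=
    Multiset.map_congr rfl fun j _ => μ.card_filter_rowLens j
  rw [h2, Multiset.filter_map]
  have h3 : (Multiset.range n).filter ((fun m => 0 < m) ∘ μ.colLen) =
      Multiset.range (μ.rowLen 0) := by
    change ((Finset.range n).filter ((fun m => 0 < m) ∘ μ.colLen)).val =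
      (Finset.range (μ.rowLen 0)).val
    congr 1
    ext j
    simp only [Finset.mem_filter, Finset.mem_range, Function.comp,
      ← mem_iff_lt_rowLen, ← mem_iff_lt_colLen, and_iff_right_iff_imp]
    intro h
    exact (mem_iff_lt_rowLen.1 h).trans_le (hμ ▸ μ.rowLen_le_card 0)
  rw [h3, rowLens, colLen_transpose]
  change _ = (Multiset.range (μ.rowLen 0)).map μ.transpose.rowLen
  exact Multiset.map_congr rfl fun j _ => (μ.rowLen_transpose j).symm

lemma toPartition_surjective {n : ℕ} (P : n.Partition) :
    ∃ (μ : YoungDiagram) (hμ : μ.card = n), μ.toPartition hμ = P := by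
  have hs : (P.parts.sort (· ≥ ·)).SortedGE := (Multiset.pairwise_sort P.parts (· ≥ ·)).sortedGE
  have hpos : ∀ x ∈ P.parts.sort (· ≥ ·), 0 < x := fun x hx =>
    P.parts_pos ((Multiset.mem_sort _).1 hx)
  have hr : ((ofRowLens _ hs).rowLens : Multiset ℕ) = P.parts := by
    rw [rowLens_ofRowLens_eq_self hpos, Multiset.sort_eq]
  refine ⟨ofRowLens _ hs, ?_, Nat.Partition.ext hr⟩
  rw [← sum_rowLens, ← Multiset.sum_coe, hr, P.parts_sum]

end YoungDiagram

lemma s_eq_card_diagrams (n : ℕ) :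
    s n = {μ : YoungDiagram | μ.card = n ∧ μ.transpose = μ}.ncard := by
  rw [s, ← Nat.card_eq_fintype_card, ← Nat.card_coe_set_eq]
  let f : {μ : YoungDiagram | μ.card = n ∧ μ.transpose = μ} →
      {P : n.Partition // P.parts = conjParts P} := fun μ =>
    ⟨μ.1.toPartition μ.2.1, by
      rw [YoungDiagram.conjParts_toPartition]
      exact congrArg (fun ν : YoungDiagram => (ν.rowLens : Multiset ℕ)) μ.2.2.symm⟩
  refine (Nat.card_congr (Equiv.ofBijective f ⟨fun μ ν h => ?_, ?_⟩)).symm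
  · have := congrArg (fun P => P.1.parts) h
    exact Subtype.ext (YoungDiagram.coe_rowLens_inj.1 this)
  · rintro ⟨P, hP⟩
    obtain ⟨μ, hμ, rfl⟩ := YoungDiagram.toPartition_surjective P
    rw [YoungDiagram.conjParts_toPartition] at hP
    exact ⟨⟨μ, hμ, (YoungDiagram.coe_rowLens_inj.1 hP).symm⟩, rfl⟩

namespace YoungDiagram

lemma transpose_eq_self_iff {μ : YoungDiagram} :
    μ.transpose = μ ↔ ∀ i j, (i, j) ∈ μ → (j, i) ∈ μ := by
  refine ⟨fun h i j hij => ?_, fun h => ?_⟩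
  · rw [← h, mem_transpose]
    exact hij
  · ext ⟨i, j⟩
    simp only [mem_cells, mem_transpose, Prod.swap_prod_mk]
    exact ⟨h j i, h i j⟩

/-- The diagonal shift `(i, j) ↦ (i + 1, j + 1)`. -/
def diagShift : ℕ × ℕ ↪ ℕ × ℕ :=
  ⟨fun c => (c.1 + 1, c.2 + 1), fun a b h => by simpa [Prod.ext_iff] using h⟩

/-- The diagram obtained by deleting the first row and the first column. -/
noncomputable def peel (μ : YoungDiagram) : YoungDiagram where
  cells := μ.cells.preimage diagShift diagShift.injective.injOn
  isLowerSet := by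
    rintro ⟨i2, j2⟩ ⟨i1, j1⟩ ⟨hi : i1 ≤ i2, hj : j1 ≤ j2⟩ h
    simp only [Finset.coe_preimage, Set.mem_preimage, Finset.mem_coe, mem_cells] at h ⊢
    exact μ.up_left_mem (Nat.succ_le_succ hi) (Nat.succ_le_succ hj) h

lemma mem_peel {μ : YoungDiagram} {i j : ℕ} : (i, j) ∈ μ.peel ↔ (i + 1, j + 1) ∈ μ := by
  rw [← mem_cells, peel, Finset.mem_preimage]
  rfl

/-- The cells of the symmetric hook with arm length `m`. -/
def hookCells (m : ℕ) : Finset (ℕ × ℕ) :=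
  (Finset.range (m + 1)).image (fun j => (0, j)) ∪ (Finset.range m).image (fun i => (i + 1, 0))

lemma mem_hookCells {m i j : ℕ} :
    (i, j) ∈ hookCells m ↔ i ≤ m ∧ j ≤ m ∧ (i = 0 ∨ j = 0) := by
  simp only [hookCells, Finset.mem_union, Finset.mem_image, Finset.mem_range, Prod.mk.injEq]
  constructor
  · rintro (⟨a, ha, rfl, rfl⟩ | ⟨a, ha, rfl, rfl⟩) <;> omega
  · rintro ⟨hi, hj, h⟩
    rcases Nat.eq_zero_or_pos i with rfl | hi'
    · exact Or.inl ⟨j, by omega, rfl, rfl⟩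
    · exact Or.inr ⟨i - 1, by omega, by omega, by omega⟩

lemma card_hookCells (m : ℕ) : (hookCells m).card = 2 * m + 1 := by
  rw [hookCells, Finset.card_union_of_disjoint,
    Finset.card_image_of_injective _ fun a b h => (Prod.mk.inj h).2,
    Finset.card_image_of_injective _ fun a b h => Nat.succ_injective (Prod.mk.inj h).1,
    Finset.card_range, Finset.card_range]
  · ring
  · rw [Finset.disjoint_left]
    simp only [Finset.mem_image, Finset.mem_range]
    rintro _ ⟨a, ha, rfl⟩ ⟨b, hb, h⟩
    exact Nat.succ_ne_zero b (Prod.mk.inj h).1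

lemma mem_map_diagShift {t : Finset (ℕ × ℕ)} {i j : ℕ} :
    (i, j) ∈ t.map diagShift ↔ ∃ a b, (a, b) ∈ t ∧ i = a + 1 ∧ j = b + 1 := by
  rw [Finset.mem_map]
  constructor
  · rintro ⟨⟨a, b⟩, hab, h⟩
    exact ⟨a, b, hab, (Prod.mk.inj h).1.symm, (Prod.mk.inj h).2.symm⟩
  · rintro ⟨a, b, hab, rfl, rfl⟩
    exact ⟨(a, b), hab, rfl⟩

lemma disjoint_hookCells (m : ℕ) (t : Finset (ℕ × ℕ)) :
    Disjoint (hookCells m) (t.map diagShift) := by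
  rw [Finset.disjoint_left]
  rintro ⟨i, j⟩ h1 h2
  rw [mem_hookCells] at h1
  obtain ⟨a, b, -, rfl, rfl⟩ := mem_map_diagShift.1 h2
  omega

/-- Symmetric diagrams with `n` cells whose rows have length at most `m`. -/
def symmDiagrams (n m : ℕ) : Set YoungDiagram :=
  {μ | μ.card = n ∧ (∀ i j, (i, j) ∈ μ → (j, i) ∈ μ) ∧ (0, m) ∉ μ}

/-- Symmetric diagrams with `n` cells whose first row has length exactly `m + 1`. -/
def symmDiagramsHook (n m : ℕ) : Set YoungDiagram :=
  {μ | μ.card = n ∧ (∀ i j, (i, j) ∈ μ → (j, i) ∈ μ) ∧ (0, m) ∈ μ ∧ (0, m + 1) ∉ μ}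

lemma lt_of_mem_symm {μ : YoungDiagram} {m : ℕ} (hs : ∀ i j, (i, j) ∈ μ → (j, i) ∈ μ)
    (hm : (0, m) ∉ μ) {i j : ℕ} (h : (i, j) ∈ μ) : i < m ∧ j < m := by
  constructor
  · by_contra hi
    exact hm (μ.up_left_mem (Nat.zero_le _) (not_lt.1 hi) (hs _ _ h))
  · by_contra hj
    exact hm (μ.up_left_mem (Nat.zero_le _) (not_lt.1 hj) h)

lemma symmDiagrams_succ (n m : ℕ) :
    symmDiagrams n (m + 1) = symmDiagrams n m ∪ symmDiagramsHook n m := by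
  ext μ
  simp only [symmDiagrams, symmDiagramsHook, Set.mem_union, Set.mem_ofPred_eq]
  have : (0, m + 1) ∈ μ → (0, m) ∈ μ := μ.up_left_mem le_rfl (Nat.le_succ m)
  tauto

lemma disjoint_symmDiagrams (n m : ℕ) : Disjoint (symmDiagrams n m) (symmDiagramsHook n m) := by
  rw [Set.disjoint_left]
  rintro μ ⟨-, -, h⟩ ⟨-, -, h', -⟩
  exact h h'

lemma cells_eq_of_mem_symmDiagramsHook {n m : ℕ} {μ : YoungDiagram}
    (h : μ ∈ symmDiagramsHook n m) : μ.cells = hookCells m ∪ μ.peel.cells.map diagShift := by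
  obtain ⟨-, hs, h1, h2⟩ := h
  ext ⟨i, j⟩
  rw [Finset.mem_union, mem_hookCells, mem_map_diagShift]
  simp only [mem_cells, mem_peel]
  constructor
  · intro hij
    have := lt_of_mem_symm hs h2 hij
    by_cases h0 : i = 0 ∨ j = 0
    · left; omega
    · right
      refine ⟨i - 1, j - 1, ?_, by omega, by omega⟩
      rwa [Nat.sub_add_cancel (by omega), Nat.sub_add_cancel (by omega)]
  · rintro (⟨hi, hj, rfl | rfl⟩ | ⟨a, b, hab, rfl, rfl⟩)
    · exact μ.up_left_mem le_rfl hj h1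
    · exact hs _ _ (μ.up_left_mem le_rfl hi h1)
    · exact hab

lemma card_of_mem_symmDiagramsHook {n m : ℕ} {μ : YoungDiagram}
    (h : μ ∈ symmDiagramsHook n m) : n = 2 * m + 1 + μ.peel.card := by
  have := congrArg Finset.card (cells_eq_of_mem_symmDiagramsHook h)
  rw [Finset.card_union_of_disjoint (disjoint_hookCells _ _), card_hookCells,
    Finset.card_map] at this
  rw [← this]
  exact h.1.symm

lemma bijOn_peel {n m : ℕ} (hn : 2 * m + 1 ≤ n) :
    Set.BijOn peel (symmDiagramsHook n m) (symmDiagrams (n - (2 * m + 1)) m) := by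
  refine ⟨fun μ h => ⟨?_, fun i j hij => ?_, fun hm => ?_⟩, fun μ hμ ν hν h => ?_, fun ν hν => ?_⟩
  · have := card_of_mem_symmDiagramsHook h
    omega
  · rw [mem_peel] at hij ⊢
    exact h.2.1 _ _ hij
  · rw [mem_peel] at hm
    exact h.2.2.2 (μ.up_left_mem (Nat.zero_le _) le_rfl hm)
  · refine YoungDiagram.ext ?_
    rw [cells_eq_of_mem_symmDiagramsHook hμ, cells_eq_of_mem_symmDiagramsHook hν, h]
  · obtain ⟨hc, hs, hm⟩ := hν
    have hmem : ∀ i j, (i, j) ∈ hookCells m ∪ ν.cells.map diagShift ↔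
        (i ≤ m ∧ j ≤ m ∧ (i = 0 ∨ j = 0)) ∨ ∃ a b, (a, b) ∈ ν ∧ i = a + 1 ∧ j = b + 1 := by
      intro i j
      rw [Finset.mem_union, mem_hookCells, mem_map_diagShift]
      simp only [mem_cells]
    let μ : YoungDiagram := ⟨hookCells m ∪ ν.cells.map diagShift, by
      rintro ⟨i2, j2⟩ ⟨i1, j1⟩ ⟨hi : i1 ≤ i2, hj : j1 ≤ j2⟩ h
      rw [Finset.mem_coe, hmem] at h ⊢
      rcases h with h | ⟨a, b, hab, rfl, rfl⟩
      · left; omega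
      · have := lt_of_mem_symm hs hm hab
        by_cases h0 : i1 = 0 ∨ j1 = 0
        · left; omega
        · right
          exact ⟨i1 - 1, j1 - 1, ν.up_left_mem (by omega) (by omega) hab, by omega, by omega⟩⟩
    have hμ : ∀ i j, (i, j) ∈ μ ↔
        (i ≤ m ∧ j ≤ m ∧ (i = 0 ∨ j = 0)) ∨ ∃ a b, (a, b) ∈ ν ∧ i = a + 1 ∧ j = b + 1 := hmem
    refine ⟨μ, ⟨?_, fun i j => ?_, ?_, ?_⟩, ?_⟩
    · change (hookCells m ∪ ν.cells.map diagShift).card = n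
      rw [Finset.card_union_of_disjoint (disjoint_hookCells _ _), card_hookCells, Finset.card_map]
      change 2 * m + 1 + ν.card = n
      omega
    · rw [hμ, hμ]
      rintro (h | ⟨a, b, hab, rfl, rfl⟩)
      · left; omega
      · exact Or.inr ⟨b, a, hs _ _ hab, rfl, rfl⟩
    · rw [hμ]; left; omega
    · rw [hμ]
      rintro (h | ⟨a, b, hab, h, -⟩) <;> omega
    · ext ⟨i, j⟩
      rw [mem_cells, mem_cells, mem_peel, hμ]
      constructor
      · rintro (h | ⟨a, b, hab, h1, h2⟩)
        · omega
        · obtain rfl : i = a := by omega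
          obtain rfl : j = b := by omega
          exact hab
      · exact fun h => Or.inr ⟨i, j, h, rfl, rfl⟩

open Polynomial in
lemma ncard_symmDiagrams (m : ℕ) : ∀ n, (symmDiagrams n m).Finite ∧
    (symmDiagrams n m).ncard = (∏ k ∈ Finset.range m, (1 + X ^ (2 * k + 1) : ℕ[X])).coeff n := by
  induction m with
  | zero =>
    intro n
    have hbot : ∀ μ : YoungDiagram, (0, 0) ∉ μ ↔ μ = ⊥ := by
      intro μ
      refine ⟨fun h => ?_, fun h => h ▸ notMem_bot _⟩
      ext ⟨i, j⟩
      simp only [mem_cells, notMem_bot, iff_false]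
      exact fun hij => h (μ.up_left_mem (Nat.zero_le _) (Nat.zero_le _) hij)
    rcases Nat.eq_zero_or_pos n with rfl | hn
    · have : symmDiagrams 0 0 = {⊥} := by
        ext μ
        simp only [symmDiagrams, Set.mem_ofPred_eq, hbot, Set.mem_singleton_iff]
        refine ⟨fun h => h.2.2, ?_⟩
        rintro rfl
        exact ⟨by simp, fun i j h => absurd h (notMem_bot _), rfl⟩
      rw [this]
      simp
    · have : symmDiagrams n 0 = ∅ := by
        ext μ
        simp only [symmDiagrams, Set.mem_ofPred_eq, hbot, Set.mem_empty_iff_false, iff_false]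
        rintro ⟨h, -, rfl⟩
        have h0 : (⊥ : YoungDiagram).card = 0 := by simp
        omega
      rw [this]
      simp [Polynomial.coeff_one, hn.ne']
  | succ m ih =>
    intro n
    rw [symmDiagrams_succ, Finset.prod_range_succ, mul_add, mul_one, Polynomial.coeff_add,
      Polynomial.coeff_mul_X_pow']
    by_cases hn : 2 * m + 1 ≤ n
    · have hb := bijOn_peel hn
      have hfin : (symmDiagramsHook n m).Finite := hb.finite_iff_finite.2 (ih _).1
      refine ⟨(ih n).1.union hfin, ?_⟩
      rw [Set.ncard_union_eq (disjoint_symmDiagrams n m) (ih n).1 hfin, (ih n).2, if_pos hn,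
        ← (ih (n - (2 * m + 1))).2, ← hb.image_eq, hb.injOn.ncard_image]
    · have he : symmDiagramsHook n m = ∅ := by
        rw [Set.eq_empty_iff_forall_notMem]
        intro μ hμ
        have := card_of_mem_symmDiagramsHook hμ
        omega
      rw [he, Set.union_empty, if_neg hn, add_zero]
      exact ih n

end YoungDiagram

open Polynomial in
/-- Self-conjugate partitions are equinumerous with partitions into distinct odd parts. -/
lemma s_eq_coeff {n N : ℕ} (h : n ≤ N) :
    s n = (∏ k ∈ Finset.range N, (1 + X ^ (2 * k + 1) : ℕ[X])).coeff n := by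
  rw [s_eq_card_diagrams, ← (YoungDiagram.ncard_symmDiagrams N n).2]
  congr 1
  ext μ
  simp only [YoungDiagram.symmDiagrams, Set.mem_ofPred_eq, YoungDiagram.transpose_eq_self_iff]
  refine ⟨fun hμ => ⟨hμ.1, hμ.2, fun h0 => ?_⟩, fun hμ => ⟨hμ.1, hμ.2.1⟩⟩
  have h1 := YoungDiagram.mem_iff_lt_rowLen.1 h0
  have h2 := μ.rowLen_le_card 0
  have h3 := hμ.1
  omega

open Complex

open Polynomial in
lemma integral_eval_mul_exp (P : ℂ[X]) (t : ℝ) (n : ℕ) :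
    ∫ θ in (-Real.pi)..Real.pi, P.eval (cexp (-(t - θ * I))) * cexp (-(n * θ * I)) =
      2 * Real.pi * P.coeff n * cexp (-(n * t)) := by
  have hexp : ∀ (k : ℕ) (θ : ℝ), cexp (-(t - θ * I)) ^ k * cexp (-(n * θ * I)) =
      cexp (-(k * t)) * cexp (((k - n : ℤ) * I) * θ) := by
    intro k θ
    rw [← Complex.exp_nat_mul, ← Complex.exp_add, ← Complex.exp_add]
    congr 1
    push_cast
    ring
  have horth : ∀ k : ℕ, ∫ θ in (-Real.pi)..Real.pi, cexp (((k - n : ℤ) * I) * θ) =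
      if k = n then (2 * Real.pi : ℂ) else 0 := by
    intro k
    split_ifs with h
    · subst h
      simp
      ring
    · have hk : ((k - n : ℤ) * I : ℂ) ≠ 0 :=
        mul_ne_zero (Int.cast_ne_zero.2 (by omega)) I_ne_zero
      rw [integral_exp_mul_complex hk]
      have : cexp (((k - n : ℤ) * I) * (Real.pi : ℝ)) =
          cexp (((k - n : ℤ) * I) * ((-Real.pi : ℝ) : ℂ)) := by
        rw [Complex.exp_eq_exp_iff_exists_int]
        refine ⟨k - n, ?_⟩
        push_cast
        ring
      rw [this, sub_self, zero_div]
  simp only [Polynomial.eval_eq_sum_range, Finset.sum_mul, mul_assoc (P.coeff _), hexp]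
  rw [intervalIntegral.integral_finsetSum
    fun k _ => (by fun_prop : Continuous _).intervalIntegrable _ _]
  simp only [intervalIntegral.integral_const_mul, horth]
  simp only [mul_ite, mul_zero, Finset.sum_ite_eq', Finset.mem_range]
  split_ifs with h
  · ring
  · rw [P.coeff_eq_zero_of_natDegree_lt (by omega)]
    ring

lemma norm_exp_neg_sub (t θ : ℝ) : ‖cexp (-(t - θ * I))‖ = Real.exp (-t) := by
  simp [Complex.norm_exp]

open Polynomial in
lemma eval_prod_odd (N : ℕ) (q : ℂ) :
    ((∏ k ∈ Finset.range N, (1 + X ^ (2 * k + 1) : ℕ[X])).map (Nat.castRingHom ℂ)).eval q =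
      ∏ k ∈ Finset.range N, (1 + q ^ (2 * k + 1)) := by
  simp [Polynomial.map_prod, Polynomial.eval_prod]

lemma measurable_oddProd_comp {α : Type*} [MeasurableSpace α]
    {q : α → ℂ} (hq : Measurable q) (hq1 : ∀ x, ‖q x‖ < 1) :
    Measurable fun x => oddProd (q x) := by
  refine measurable_of_tendsto_metrizable (f := fun N x => ∏ k ∈ Finset.range N,
    (1 + q x ^ (2 * k + 1))) (fun N => by fun_prop) ?_
  rw [tendsto_pi_nhds]
  exact fun x => tendsto_oddProd (hq1 x)

/-- The Cauchy formula for the coefficients of the generating function. -/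
lemma integral_oddProd_mul_exp {t : ℝ} (ht : 0 < t) (n : ℕ) :
    ∫ θ in (-Real.pi)..Real.pi, oddProd (cexp (-(t - θ * I))) * cexp (-(n * θ * I)) =
      2 * Real.pi * s n * cexp (-(n * t)) := by
  have hq : ∀ θ : ℝ, ‖cexp (-(t - θ * I))‖ < 1 := fun θ => by
    rw [norm_exp_neg_sub, Real.exp_lt_one_iff]
    linarith
  have hconst : ∀ᶠ N : ℕ in atTop, ∫ θ in (-Real.pi)..Real.pi,
      (∏ k ∈ Finset.range N, (1 + cexp (-(t - θ * I)) ^ (2 * k + 1))) * cexp (-(n * θ * I)) =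
        2 * Real.pi * s n * cexp (-(n * t)) := by
    filter_upwards [eventually_ge_atTop n] with N hN
    simp only [← eval_prod_odd]
    rw [integral_eval_mul_exp, Polynomial.coeff_map, ← s_eq_coeff hN]
    rfl
  refine tendsto_nhds_unique ?_ (tendsto_const_nhds.congr' (hconst.mono fun _ h => h.symm))
  refine intervalIntegral.tendsto_integral_filter_of_dominated_convergence
    (fun _ => Real.exp (Real.exp (-t) / (1 - Real.exp (-t) ^ 2))) ?_ ?_ ?_ ?_
  · exact Eventually.of_forall fun N => (by fun_prop : Continuous _).aestronglyMeasurable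
  · refine Eventually.of_forall fun N => Eventually.of_forall fun θ _ => ?_
    rw [norm_mul]
    have h1 : ‖cexp (-(n * θ * I))‖ = 1 := by simp [Complex.norm_exp]
    rw [h1, mul_one, ← norm_exp_neg_sub t θ]
    exact norm_prod_odd_le (hq θ) N
  · exact intervalIntegrable_const
  · exact Eventually.of_forall fun θ _ => (tendsto_oddProd (hq θ)).mul_const _

/-- The normalised Cauchy integrand near the saddle point, with saddle value `exp (r ^ 2)` and
radius `exp (-π² / (24 r²))`. -/
noncomputable def saddleFun (r y : ℝ) : ℂ :=
  oddProd (cexp (-((Real.pi ^ 2 / (24 * r ^ 2) : ℝ) -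
    (Real.pi ^ 2 / (24 * r ^ 2) / r * y : ℝ) * I))) * cexp (-(r ^ 2 + r * y * I))

lemma saddleFun_eq {r : ℝ} (hr : 0 < r) (y : ℝ) :
    saddleFun r y = cexp (-(y ^ 2 / (1 - (y / r : ℝ) * I))) *
      cexp (-((Real.pi ^ 2 / (24 * r ^ 2) / 24 : ℝ) * (1 - (y / r : ℝ) * I))) *
        oddProd (cexp (-(24 * r ^ 2 / (1 - (y / r : ℝ) * I)))) := by
  have hw : (1 - (y / r : ℝ) * I : ℂ) ≠ 0 := by
    intro h
    simpa using congrArg Complex.re h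
  have hr' : (r : ℂ) ≠ 0 := by exact_mod_cast hr.ne'
  have hpi : (Real.pi : ℂ) ≠ 0 := by exact_mod_cast Real.pi_ne_zero
  have ht : 0 < Real.pi ^ 2 / (24 * r ^ 2) := by positivity
  have hz : ((Real.pi ^ 2 / (24 * r ^ 2) : ℝ) : ℂ) -
      (Real.pi ^ 2 / (24 * r ^ 2) / r * y : ℝ) * I =
        (Real.pi ^ 2 / (24 * r ^ 2) : ℝ) * (1 - (y / r : ℝ) * I) := by
    push_cast
    ring
  have hy : (y : ℂ) ^ 2 = -(r ^ 2 * (1 - (1 - (y / r : ℝ) * I)) ^ 2) := by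
    push_cast
    field_simp
    linear_combination (y : ℂ) ^ 2 * I_sq
  have hy' : (r * y * I : ℂ) = r ^ 2 * (1 - (1 - (y / r : ℝ) * I)) := by
    push_cast
    field_simp
    ring
  rw [saddleFun, hz, oddProd_exp_neg (by rw [Complex.re_ofReal_mul]; simpa using ht), hy, hy']
  generalize (1 - (y / r : ℝ) * I : ℂ) = w at hw
  rw [mul_right_comm, ← Complex.exp_add, ← Complex.exp_add]
  refine congrArg₂ (· * ·) (congrArg cexp ?_) (congrArg (fun z => oddProd (cexp z)) ?_)
  · push_cast
    field_simp
    ring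
  · push_cast
    field_simp

lemma re_inv_one_sub_mul_I (u : ℝ) : ((1 - u * I : ℂ)⁻¹).re = (1 + u ^ 2)⁻¹ := by
  rw [Complex.inv_re, Complex.normSq_apply]
  simp
  ring

lemma norm_exp_neg_div (a u : ℝ) :
    ‖cexp (-(a / (1 - u * I)))‖ = Real.exp (-(a * (1 + u ^ 2)⁻¹)) := by
  rw [Complex.norm_exp, Complex.neg_re, div_eq_mul_inv, Complex.re_ofReal_mul,
    re_inv_one_sub_mul_I]

lemma norm_saddleFun_le_of_abs_le {r y : ℝ} (hr : 1 ≤ r) (hy : |y| ≤ r) :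
    ‖saddleFun r y‖ ≤ Real.exp 1 * Real.exp (-(y ^ 2 / 2)) := by
  have hr0 : 0 < r := by linarith
  have hu : (1 / 2 : ℝ) ≤ (1 + (y / r) ^ 2)⁻¹ := by
    rw [one_div]
    gcongr
    have : (y / r) ^ 2 ≤ 1 := by
      rw [div_pow, div_le_one (by positivity)]
      exact sq_le_sq' (by linarith [neg_abs_le y]) ((le_abs_self y).trans hy)
    linarith
  have h1 := norm_exp_neg_div (y ^ 2) (y / r)
  have h2 := norm_exp_neg_div (24 * r ^ 2) (y / r)
  have h3 : ‖cexp (-((Real.pi ^ 2 / (24 * r ^ 2) / 24 : ℝ) * (1 - (y / r : ℝ) * I)))‖ ≤ 1 := by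
    rw [Complex.norm_exp, Complex.neg_re, Complex.re_ofReal_mul]
    simp only [Complex.sub_re, Complex.one_re, Complex.re_ofReal_mul, Complex.I_re, mul_zero,
      sub_zero, mul_one, Real.exp_le_one_iff, Left.neg_nonpos_iff]
    positivity
  have h4 : ‖oddProd (cexp (-(24 * r ^ 2 / (1 - (y / r : ℝ) * I))))‖ ≤ Real.exp 1 := by
    apply norm_oddProd_le_exp_one
    push_cast at h2 ⊢
    rw [h2]
    apply exp_neg_le_half
    nlinarith
  rw [saddleFun_eq hr0, norm_mul, norm_mul, mul_comm]
  gcongr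
  push_cast at h1 h3 ⊢
  rw [h1]
  refine (mul_le_of_le_one_right (Real.exp_nonneg _) h3).trans ?_
  gcongr
  nlinarith [sq_nonneg y]

lemma norm_saddleFun_le_of_le_abs {r y : ℝ} (hr : 1 ≤ r) (hy : r ≤ |y|)
    (hy' : |y| ≤ 24 * r ^ 3 / Real.pi) :
    ‖saddleFun r y‖ ≤ Real.exp 1 * Real.exp (-(r ^ 2 / 80)) := by
  have hr0 : 0 < r := by linarith
  have hpi3 := Real.pi_gt_three
  have hpi10 : Real.pi ^ 2 ≤ 10 := by nlinarith [Real.pi_lt_d2, Real.pi_pos]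
  have ht : 0 < Real.pi ^ 2 / (24 * r ^ 2) := by positivity
  have habs : |Real.pi ^ 2 / (24 * r ^ 2) / r * y| = Real.pi ^ 2 / (24 * r ^ 2) / r * |y| := by
    rw [abs_mul, abs_of_pos (by positivity)]
  have h := norm_oddProd_minor_le (t := Real.pi ^ 2 / (24 * r ^ 2))
    (θ := Real.pi ^ 2 / (24 * r ^ 2) / r * y) ht ?_ ?_ ?_
  · have h1 : ‖cexp (-(r ^ 2 + r * y * I))‖ = Real.exp (-r ^ 2) := by
      rw [Complex.norm_exp]
      congr 1
      simp [← Complex.ofReal_pow]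
    rw [saddleFun, norm_mul, h1]
    refine (mul_le_mul_of_nonneg_right h (Real.exp_nonneg _)).trans ?_
    rw [mul_assoc, ← Real.exp_add]
    gcongr
    have e1 : Real.pi ^ 2 / (24 * (Real.pi ^ 2 / (24 * r ^ 2))) = r ^ 2 := by
      field_simp
    have e2 : 1 / (176 * (Real.pi ^ 2 / (24 * r ^ 2))) = r ^ 2 * (3 / 22) / Real.pi ^ 2 := by
      field_simp
      norm_num
    have e3 : r ^ 2 / 80 ≤ r ^ 2 * (3 / 22) / Real.pi ^ 2 := by
      rw [div_le_div_iff₀ (by norm_num) (by positivity)]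
      nlinarith [sq_nonneg r]
    rw [e1, e2]
    linarith
  · rw [div_le_div_iff₀ (by positivity) (by norm_num)]
    nlinarith
  · rw [habs]
    calc _ = Real.pi ^ 2 / (24 * r ^ 2) / r * r := by field_simp
      _ ≤ _ := by gcongr
  · rw [habs]
    calc _ ≤ Real.pi ^ 2 / (24 * r ^ 2) / r * (24 * r ^ 3 / Real.pi) := by gcongr
      _ = _ := by field_simp

/-- A uniform integrable bound for the normalised integrand. -/
lemma norm_saddleFun_le {r y : ℝ} (hr : 1 ≤ r) (hy : |y| ≤ 24 * r ^ 3 / Real.pi) :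
    ‖saddleFun r y‖ ≤ Real.exp 1 * (65 * (6 * 80 ^ 3)) * (1 + y ^ 2)⁻¹ := by
  have hr0 : 0 < r := by linarith
  rcases le_total |y| r with h | h
  · refine (norm_saddleFun_le_of_abs_le hr h).trans ?_
    rw [mul_assoc]
    gcongr
    rw [Real.exp_neg, ← div_eq_mul_inv, inv_eq_one_div,
      div_le_div_iff₀ (Real.exp_pos _) (by positivity)]
    nlinarith [Real.add_one_le_exp (y ^ 2 / 2), sq_nonneg y]
  · refine (norm_saddleFun_le_of_le_abs hr h hy).trans ?_
    rw [mul_assoc]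
    gcongr
    rw [Real.exp_neg, ← div_eq_mul_inv, inv_eq_one_div,
      div_le_div_iff₀ (Real.exp_pos _) (by positivity)]
    have h1 : (r ^ 2 / 80) ^ 3 / 6 ≤ Real.exp (r ^ 2 / 80) := by
      simpa [Nat.factorial] using Real.pow_div_factorial_le_exp (r ^ 2 / 80) (by positivity) 3
    have h2 : |y| ≤ 8 * r ^ 3 := by
      refine hy.trans ?_
      rw [div_le_iff₀ Real.pi_pos]
      nlinarith [Real.pi_gt_three, pow_pos hr0 3]
    have h3 : y ^ 2 ≤ (8 * r ^ 3) ^ 2 := by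
      rw [← sq_abs y]
      gcongr
    have h4 : 1 ≤ r ^ 6 := one_le_pow₀ hr
    nlinarith

lemma tendsto_saddleFun (y : ℝ) :
    Tendsto (fun r => saddleFun r y) atTop (𝓝 (cexp (-(y : ℂ) ^ 2))) := by
  have hw : Tendsto (fun r : ℝ => (1 - (y / r : ℝ) * I : ℂ)) atTop (𝓝 1) := by
    have h1 : Tendsto (fun r : ℝ => ((y / r : ℝ) : ℂ)) atTop (𝓝 ((0 : ℝ) : ℂ)) :=
      (Complex.continuous_ofReal.tendsto 0).comp (tendsto_const_nhds.div_atTop tendsto_id)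
    simpa using (h1.mul_const I).const_sub 1
  have ht : Tendsto (fun r : ℝ => ((Real.pi ^ 2 / (24 * r ^ 2) / 24 : ℝ) : ℂ)) atTop
      (𝓝 ((0 : ℝ) : ℂ)) := by
    refine (Complex.continuous_ofReal.tendsto 0).comp ?_
    have : Tendsto (fun r : ℝ => Real.pi ^ 2 / (24 * r ^ 2)) atTop (𝓝 0) :=
      tendsto_const_nhds.div_atTop
        ((tendsto_pow_atTop two_ne_zero).const_mul_atTop (by norm_num))
    simpa using this.div_const 24
  have h1 : Tendsto (fun r : ℝ => cexp (-(y ^ 2 / (1 - (y / r : ℝ) * I)))) atTop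
      (𝓝 (cexp (-(y ^ 2 / 1)))) :=
    (Complex.continuous_exp.tendsto _).comp (tendsto_const_nhds.div hw one_ne_zero).neg
  have h2 : Tendsto (fun r : ℝ => cexp (-((Real.pi ^ 2 / (24 * r ^ 2) / 24 : ℝ) *
      (1 - (y / r : ℝ) * I)))) atTop (𝓝 (cexp (-((0 : ℝ) * 1)))) :=
    (Complex.continuous_exp.tendsto _).comp (ht.mul hw).neg
  have h3 : Tendsto (fun r : ℝ => oddProd (cexp (-(24 * r ^ 2 / (1 - (y / r : ℝ) * I))))) atTop
      (𝓝 1) := by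
    refine tendsto_oddProd_zero.comp ?_
    rw [tendsto_zero_iff_norm_tendsto_zero]
    have e : ∀ r : ℝ, ‖cexp (-(24 * r ^ 2 / (1 - (y / r : ℝ) * I)))‖ =
        Real.exp (-(24 * r ^ 2 * (1 + (y / r) ^ 2)⁻¹)) := fun r => by
      rw [← norm_exp_neg_div]
      push_cast
      rfl
    simp only [e]
    refine Real.tendsto_exp_neg_atTop_nhds_zero.comp ?_
    have hu : Tendsto (fun r : ℝ => (1 + (y / r) ^ 2)⁻¹) atTop (𝓝 1) := by
      have h : Tendsto (fun r : ℝ => y / r) atTop (𝓝 0) := tendsto_const_nhds.div_atTop tendsto_id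
      simpa using ((h.pow 2).const_add 1).inv₀ (by norm_num)
    exact ((tendsto_pow_atTop two_ne_zero).const_mul_atTop (by norm_num)).atTop_mul_pos
      one_pos hu
  have h := (h1.mul h2).mul h3
  simp only [div_one, Complex.ofReal_zero, neg_zero, Complex.exp_zero, mul_one] at h
  refine h.congr' ?_
  filter_upwards [eventually_gt_atTop 0] with r hr
  rw [saddleFun_eq hr]

lemma measurable_saddleFun {r : ℝ} (hr : 0 < r) : Measurable (saddleFun r) := by
  refine (measurable_oddProd_comp (by fun_prop) fun y => ?_).mul (by fun_prop)
  rw [norm_exp_neg_sub, Real.exp_lt_one_iff]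
  have : 0 < Real.pi ^ 2 / (24 * r ^ 2) := by positivity
  linarith

lemma tendsto_integral_saddleFun :
    Tendsto (fun r : ℝ => ∫ y in (-(24 * r ^ 3 / Real.pi))..(24 * r ^ 3 / Real.pi), saddleFun r y)
      atTop (𝓝 (Real.sqrt Real.pi : ℝ)) := by
  have hgauss : ∫ y : ℝ, cexp (-(y : ℂ) ^ 2) = (Real.sqrt Real.pi : ℝ) := by
    have h := integral_gaussian 1
    simp only [div_one] at h
    rw [← h, ← integral_complex_ofReal]
    simp
  rw [← hgauss]
  have heq : ∀ᶠ r : ℝ in atTop,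
      ∫ y, (Set.Ioc (-(24 * r ^ 3 / Real.pi)) (24 * r ^ 3 / Real.pi)).indicator (saddleFun r) y =
        ∫ y in (-(24 * r ^ 3 / Real.pi))..(24 * r ^ 3 / Real.pi), saddleFun r y := by
    filter_upwards [eventually_gt_atTop 0] with r hr
    have : 0 < 24 * r ^ 3 / Real.pi := by positivity
    rw [intervalIntegral.integral_of_le (by linarith),
      MeasureTheory.integral_indicator measurableSet_Ioc]
  refine Tendsto.congr' heq ?_
  refine MeasureTheory.tendsto_integral_filter_of_dominated_convergence
    (fun y => Real.exp 1 * (65 * (6 * 80 ^ 3)) * (1 + y ^ 2)⁻¹) ?_ ?_ ?_ ?_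
  · filter_upwards [eventually_gt_atTop 0] with r hr
    exact ((measurable_saddleFun hr).indicator measurableSet_Ioc).aestronglyMeasurable
  · filter_upwards [eventually_ge_atTop 1] with r hr
    refine Eventually.of_forall fun y => ?_
    by_cases hy : y ∈ Set.Ioc (-(24 * r ^ 3 / Real.pi)) (24 * r ^ 3 / Real.pi)
    · rw [Set.indicator_of_mem hy]
      exact norm_saddleFun_le hr (abs_le.2 ⟨hy.1.le, hy.2⟩)
    · rw [Set.indicator_of_notMem hy, norm_zero]
      positivity
  · exact integrable_inv_one_add_sq.const_mul _
  · refine Eventually.of_forall fun y => (tendsto_saddleFun y).congr' ?_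
    have hR : Tendsto (fun r : ℝ => 24 * r ^ 3 / Real.pi) atTop atTop :=
      ((tendsto_pow_atTop three_ne_zero).const_mul_atTop (by norm_num)).atTop_div_const Real.pi_pos
    filter_upwards [hR.eventually_gt_atTop |y|] with r hr
    rw [Set.indicator_of_mem]
    exact ⟨(abs_lt.1 hr).1, (abs_lt.1 hr).2.le⟩

lemma integral_saddleFun {r : ℝ} (hr : 0 < r) {n : ℕ}
    (hn : (n : ℝ) * Real.pi ^ 2 = 24 * r ^ 4) :
    ∫ y in (-(24 * r ^ 3 / Real.pi))..(24 * r ^ 3 / Real.pi), saddleFun r y =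
      ((48 * r ^ 3 / Real.pi * s n / Real.exp (2 * r ^ 2) : ℝ) : ℂ) := by
  have hpi := Real.pi_pos
  have ht : 0 < Real.pi ^ 2 / (24 * r ^ 2) := by positivity
  have hnt : (n : ℝ) * (Real.pi ^ 2 / (24 * r ^ 2)) = r ^ 2 := by
    rw [← mul_div_assoc, hn]
    field_simp
  let f : ℝ → ℂ := fun θ =>
    oddProd (cexp (-((Real.pi ^ 2 / (24 * r ^ 2) : ℝ) - θ * I))) * cexp (-(n * θ * I))
  have hF : ∀ y : ℝ, saddleFun r y =
      cexp (-(r ^ 2 : ℝ)) * f (Real.pi ^ 2 / (24 * r ^ 2) / r * y) := by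
    intro y
    have h : (n : ℂ) * (Real.pi ^ 2 / (24 * r ^ 2) / r * y : ℝ) = (r * y : ℝ) := by
      rw [← Complex.ofReal_natCast, ← Complex.ofReal_mul]
      congr 1
      rw [← mul_assoc, ← mul_div_assoc, hnt]
      field_simp
    simp only [f, h]
    rw [saddleFun, mul_left_comm, ← Complex.exp_add]
    congr 2
    push_cast
    ring
  simp only [hF]
  rw [intervalIntegral.integral_const_mul,
    intervalIntegral.integral_comp_mul_left f (by positivity)]
  have e1 : Real.pi ^ 2 / (24 * r ^ 2) / r * (24 * r ^ 3 / Real.pi) = Real.pi := by field_simp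
  rw [mul_neg, e1, integral_oddProd_mul_exp ht]
  have e2 : (-(n * (Real.pi ^ 2 / (24 * r ^ 2) : ℝ)) : ℂ) = (-(r ^ 2) : ℝ) := by
    rw [← Complex.ofReal_natCast, ← Complex.ofReal_mul, hnt, Complex.ofReal_neg]
  rw [e2, Complex.real_smul, ← Complex.ofReal_neg, ← Complex.ofReal_exp, two_mul (r ^ 2),
    Real.exp_add, Real.exp_neg]
  push_cast
  have hr' : (r : ℂ) ≠ 0 := by exact_mod_cast hr.ne'
  have hpi' : (Real.pi : ℂ) ≠ 0 := by exact_mod_cast Real.pi_ne_zero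
  field_simp
  ring

/-- `s n ∼ e^{(c/2)√n} / (2^{7/4} 3^{1/4} n^{3/4})` as `n → ∞`. -/
theorem selfConjugate_asymptotic :
    Tendsto (fun n : ℕ =>
        (s n : ℝ) * ((2 : ℝ) ^ (7 / 4 : ℝ) * (3 : ℝ) ^ (1 / 4 : ℝ) * (n : ℝ) ^ (3 / 4 : ℝ)) /
          Real.exp (c / 2 * Real.sqrt n))
      atTop (nhds 1) := by
  have hpi := Real.pi_pos
  have hc : 0 < c := by
    unfold c
    positivity
  have hc2 : c ^ 2 = 2 * Real.pi ^ 2 / 3 := by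
    rw [c, mul_pow, Real.sq_sqrt (by positivity)]
    ring
  have hr : Tendsto (fun n : ℕ => Real.sqrt (c / 4 * Real.sqrt n)) atTop atTop :=
    Real.tendsto_sqrt_atTop.comp ((Real.tendsto_sqrt_atTop.comp
      tendsto_natCast_atTop_atTop).const_mul_atTop (by positivity))
  have hlim := (Complex.continuous_re.tendsto _).comp (tendsto_integral_saddleFun.comp hr)
  have h := hlim.div_const (Real.sqrt Real.pi)
  rw [Complex.ofReal_re, div_self (by positivity)] at h
  refine h.congr' ?_
  filter_upwards [eventually_gt_atTop 0] with n hn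
  have hn0 : (0 : ℝ) < n := by exact_mod_cast hn
  have hr0 : 0 < Real.sqrt (c / 4 * Real.sqrt n) := by positivity
  have hr2 : Real.sqrt (c / 4 * Real.sqrt n) ^ 2 = c / 4 * Real.sqrt n :=
    Real.sq_sqrt (by positivity)
  simp only [Function.comp]
  generalize Real.sqrt (c / 4 * Real.sqrt n) = r at hr0 hr2
  have hr4 : (n : ℝ) * Real.pi ^ 2 = 24 * r ^ 4 := by
    rw [show r ^ 4 = (r ^ 2) ^ 2 by ring, hr2, mul_pow, Real.sq_sqrt hn0.le, div_pow, hc2]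
    ring
  rw [integral_saddleFun hr0 hr4, Complex.ofReal_re,
    show c / 2 * Real.sqrt n = 2 * r ^ 2 by rw [hr2]; ring]
  have hconst : (2 : ℝ) ^ (7 / 4 : ℝ) * (3 : ℝ) ^ (1 / 4 : ℝ) * (n : ℝ) ^ (3 / 4 : ℝ) =
      48 * r ^ 3 / Real.pi / Real.sqrt Real.pi := by
    rw [← pow_left_inj₀ (by positivity) (by positivity) four_ne_zero]
    have e2 : ((2 : ℝ) ^ (7 / 4 : ℝ)) ^ 4 = 2 ^ 7 := by
      rw [← Real.rpow_mul_natCast (by norm_num), ← Real.rpow_natCast]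
      norm_num
    have e3 : ((3 : ℝ) ^ (1 / 4 : ℝ)) ^ 4 = 3 := by
      rw [← Real.rpow_mul_natCast (by norm_num)]
      norm_num
    have en : ((n : ℝ) ^ (3 / 4 : ℝ)) ^ 4 = (n : ℝ) ^ 3 := by
      rw [← Real.rpow_mul_natCast hn0.le, ← Real.rpow_natCast]
      norm_num
    have es : Real.sqrt Real.pi ^ 4 = Real.pi ^ 2 := by
      rw [show Real.sqrt Real.pi ^ 4 = (Real.sqrt Real.pi ^ 2) ^ 2 by ring, Real.sq_sqrt hpi.le]
    have hn3 : (n : ℝ) = 24 * r ^ 4 / Real.pi ^ 2 := by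
      rw [eq_div_iff (by positivity), hr4]
    rw [mul_pow, mul_pow, e2, e3, en, div_pow, div_pow, es, hn3]
    field_simp
    norm_num
  rw [hconst]
  ring
end

section
/- Let c = 2√(π²/6). The proportion of self-conjugate partitions satisfies s(n)/p(n) ∼ (6n)^{1/4} · e^{−(c/2)√n} as n → ∞. -/
noncomputable section

namespace SelfConjugate

open Filter
open Complex hiding sqrt
open scoped Real Topology
/-- The filter of complex numbers tending to `0` inside the sector `|arg z| ≤ π / 4`. -/
def sectorFilter : Filter ℂ := comap re (𝓝[>] 0) ⊓ 𝓟 {z | |z.im| ≤ z.re}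

/-- The abscissa-`t` Cauchy integral recovers the coefficients of an exponential series. -/
lemma integral_mul_exp_eq_coeff {a : ℕ → ℝ} {F : ℂ → ℂ}
    (hF : ∀ z : ℂ, 0 < z.re → HasSum (fun n : ℕ => (a n : ℂ) * cexp (-(n * z))) (F z))
    {t : ℝ} (ht : 0 < t) (n : ℕ) :
    ∫ θ in (-π)..π, F (t + θ * I) * cexp (n * (t + θ * I)) = 2 * π * a n := by
  have hsum : Summable fun m : ℕ => ‖(a m : ℂ) * cexp (-(m * (t : ℂ)))‖ :=
    (hF t (by simpa using ht)).summable.norm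
  have key := intervalIntegral.hasSum_integral_of_dominated_convergence (μ := MeasureTheory.volume)
    (a := -π) (b := π)
    (F := fun (m : ℕ) (θ : ℝ) => (a m : ℂ) * cexp (-(m * (t + θ * I))) * cexp (n * (t + θ * I)))
    (f := fun θ : ℝ => F (t + θ * I) * cexp (n * (t + θ * I)))
    (fun m _ => ‖(a m : ℂ) * cexp (-(m * (t : ℂ)))‖ * Real.exp (n * t))
    (fun m => (by fun_prop : Continuous _).aestronglyMeasurable)
    (fun m => .of_forall fun θ _ => by
      simp [Complex.norm_exp])
    (.of_forall fun θ _ => hsum.mul_right _)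
    (by simp)
    (.of_forall fun θ _ => (hF _ (by simpa using ht)).mul_right _)
  refine key.unique ?_
  convert! hasSum_ite_eq n (2 * π * a n : ℂ) using 1
  funext m
  have hrw : ∀ θ : ℝ, (a m : ℂ) * cexp (-(m * (t + θ * I))) * cexp (n * (t + θ * I)) =
      (a m * cexp ((n - m) * t)) * cexp (((n - m) * I) * θ) := fun θ => by
    rw [mul_assoc, mul_assoc, ← Complex.exp_add, ← Complex.exp_add]
    congr 2
    ring
  simp_rw [hrw]
  rw [intervalIntegral.integral_const_mul]
  split_ifs with h
  · subst h
    simp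
    ring
  · have hne : ((n : ℂ) - m) * I ≠ 0 := by
      refine mul_ne_zero (sub_ne_zero.mpr ?_) I_ne_zero
      exact Nat.cast_injective.ne (Ne.symm h)
    rw [integral_exp_mul_complex hne]
    have : cexp ((n - m) * I * (π : ℝ)) = cexp ((n - m) * I * ((-π : ℝ) : ℂ)) := by
      rw [Complex.exp_eq_exp_iff_exists_int]
      exact ⟨n - m, by push_cast; ring⟩
    rw [this]
    simp

lemma continuous_vertical {a : ℕ → ℝ} {F : ℂ → ℂ}
    (hF : ∀ z : ℂ, 0 < z.re → HasSum (fun n : ℕ => (a n : ℂ) * cexp (-(n * z))) (F z))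
    {t : ℝ} (ht : 0 < t) : Continuous fun θ : ℝ => F (t + θ * I) := by
  have h : (fun θ : ℝ => F (t + θ * I)) =
      fun θ : ℝ => ∑' n : ℕ, (a n : ℂ) * cexp (-(n * (t + θ * I))) := by
    ext θ
    exact (hF _ (by simpa using ht)).tsum_eq.symm
  rw [h]
  refine continuous_tsum (fun n => by fun_prop) (hF t (by simpa using ht)).summable.norm
    fun n θ => ?_
  simp [Complex.norm_exp]

lemma tendsto_sector {x : ℝ → ℂ} {l : Filter ℝ} (h0 : Tendsto (fun t => (x t).re) l (𝓝[>] 0))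
    (h1 : ∀ᶠ t in l, |(x t).im| ≤ (x t).re) : Tendsto x l sectorFilter :=
  tendsto_inf.mpr ⟨tendsto_comap_iff.mpr h0, tendsto_principal.mpr h1⟩

lemma eventually_sector {q : ℂ → Prop} (h : ∀ᶠ z in sectorFilter, q z) :
    ∀ᶠ t : ℝ in 𝓝[>] 0, ∀ z : ℂ, z.re = t → |z.im| ≤ t → q z := by
  rw [sectorFilter, eventually_inf_principal, eventually_comap] at h
  filter_upwards [h] with t ht z hz hz'
  exact ht z hz (by simpa [hz] using hz')

/-- The exponent at the saddle point `t`. -/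
lemma saddle_exponent {A t : ℝ} (ht : 0 < t) {z : ℂ} (hz : z ≠ 0) :
    A / z + A / t ^ 2 * z - 2 * A / t = A * (z - t) ^ 2 / (z * t ^ 2) := by
  have : (t : ℂ) ≠ 0 := by exact_mod_cast ht.ne'
  field_simp
  ring

lemma ofReal_mul_cpow {t : ℝ} (ht : 0 < t) {w : ℂ} (hw : w ≠ 0) (β : ℂ) :
    ((t : ℂ) * w) ^ β = (t : ℂ) ^ β * w ^ β := by
  have ht' : (t : ℂ) ≠ 0 := by exact_mod_cast ht.ne'
  rw [cpow_def_of_ne_zero (mul_ne_zero ht' hw), cpow_def_of_ne_zero ht', cpow_def_of_ne_zero hw,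
    log_ofReal_mul ht hw, ← Complex.exp_add, ← ofReal_log ht.le]
  ring_nf

/-- On the line `Re z = t`, at height `t ^ (3/2) u`, the normalised integrand factors into the
error term of the generating function, a power, and a Gaussian-like factor. -/
lemma normalized_integrand {A β t u : ℝ} (ht : 0 < t) (Fz : ℂ) :
    Fz * cexp (A / t ^ 2 * (t + (t * √t * u : ℝ) * I)) / ((t : ℂ) ^ (β : ℂ) * cexp (2 * A / t)) =
      Fz / ((t + (t * √t * u : ℝ) * I) ^ (β : ℂ) * cexp (A / (t + (t * √t * u : ℝ) * I))) *
        (1 + (√t * u : ℝ) * I) ^ (β : ℂ) * cexp (-(A * u ^ 2) / (1 + (√t * u : ℝ) * I)) := by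
  have ht' : (t : ℂ) ≠ 0 := by exact_mod_cast ht.ne'
  have hw : (1 + (√t * u : ℝ) * I : ℂ) ≠ 0 := fun h => by
    simpa using congrArg re h
  set w : ℂ := 1 + (√t * u : ℝ) * I with hwdef
  have hz : (t + (t * √t * u : ℝ) * I : ℂ) = t * w := by
    rw [hwdef]; push_cast; ring
  rw [hz, ofReal_mul_cpow ht hw]
  have hwβ : w ^ (β : ℂ) ≠ 0 := by simp [cpow_eq_zero_iff, hw]
  have htβ : (t : ℂ) ^ (β : ℂ) ≠ 0 := by simp [cpow_eq_zero_iff, ht']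
  have hexp : cexp (A / t ^ 2 * (t * w)) =
      cexp (2 * A / t) * cexp (-(A * u ^ 2) / w) * (cexp (A / (t * w)))⁻¹ := by
    rw [← Complex.exp_neg, ← Complex.exp_add, ← Complex.exp_add]
    congr 1
    have h := saddle_exponent (A := A) ht (mul_ne_zero ht' hw)
    have h2 : (A : ℂ) * (t * w - t) ^ 2 / (t * w * t ^ 2) = -(A * u ^ 2) / w := by
      have hs : ((√t : ℝ) : ℂ) ^ 2 = t := by
        rw [← ofReal_pow, Real.sq_sqrt ht.le]
      have h3 : (t * w - t : ℂ) ^ 2 = -(t ^ 3 * u ^ 2) := by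
        rw [hwdef]
        push_cast
        linear_combination (t ^ 2 * u ^ 2 * I ^ 2 : ℂ) * hs + (t ^ 3 * u ^ 2 : ℂ) * I_sq
      rw [h3]
      field_simp
    rw [← h2, ← h]
    ring
  rw [hexp]
  have := Complex.exp_ne_zero (2 * A / t)
  have := Complex.exp_ne_zero (A / (t * w))
  field_simp

/-- The contribution of the sector to the saddle-point integral. -/
lemma tendsto_near_integral {a : ℕ → ℝ} {F : ℂ → ℂ} {A β : ℝ} {C : ℂ} (hA : 0 < A) (hβ : 0 ≤ β)
    (hF : ∀ z : ℂ, 0 < z.re → HasSum (fun n : ℕ => (a n : ℂ) * cexp (-(n * z))) (F z))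
    (hnear : Tendsto (fun z => F z / (z ^ (β : ℂ) * cexp (A / z))) sectorFilter (𝓝 C)) :
    Tendsto (fun t : ℝ => ((t * √t : ℝ) : ℂ)⁻¹ * ∫ θ in Set.Icc (-t) t,
      F (t + θ * I) * cexp (A / t ^ 2 * (t + θ * I)) / ((t : ℂ) ^ (β : ℂ) * cexp (2 * A / t)))
      (𝓝[>] 0) (𝓝 (C * (√(π / A) : ℝ))) := by
  set g : ℝ → ℝ → ℂ := fun t θ =>
    F (t + θ * I) * cexp (A / t ^ 2 * (t + θ * I)) / ((t : ℂ) ^ (β : ℂ) * cexp (2 * A / t)) with hg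
  have hpos : ∀ᶠ t : ℝ in 𝓝[>] 0, 0 < t := eventually_mem_nhdsWithin
  have hscale : ∀ᶠ t : ℝ in 𝓝[>] 0,
      ∫ u : ℝ, (Set.Icc (-t) t).indicator (g t) (t * √t * u) =
        ((t * √t : ℝ) : ℂ)⁻¹ * ∫ θ in Set.Icc (-t) t, g t θ := by
    filter_upwards [hpos] with t ht
    have := Real.sqrt_pos.mpr ht
    rw [MeasureTheory.Measure.integral_comp_mul_left (fun θ => (Set.Icc (-t) t).indicator (g t) θ),
      MeasureTheory.integral_indicator measurableSet_Icc, abs_of_pos (by positivity)]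
    simp
  refine Tendsto.congr' hscale ?_
  have hgauss : (∫ u : ℝ, C * (Real.exp (-A * u ^ 2) : ℂ)) = C * (√(π / A) : ℝ) := by
    rw [MeasureTheory.integral_const_mul, integral_complex_ofReal, integral_gaussian]
  rw [← hgauss]
  have hsqrt : Tendsto (fun t : ℝ => √t) (𝓝[>] 0) (𝓝 0) := by
    have : Tendsto (fun t : ℝ => √t) (𝓝 0) (𝓝 √0) := Real.continuous_sqrt.tendsto 0
    rw [Real.sqrt_zero] at this
    exact this.mono_left nhdsWithin_le_nhds
  have hsmall : ∀ u : ℝ, ∀ᶠ t : ℝ in 𝓝[>] 0, |√t * u| < 1 := fun u => by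
    have : Tendsto (fun t : ℝ => |√t * u|) (𝓝[>] 0) (𝓝 0) := by
      simpa using (hsqrt.mul_const u).abs
    exact this.eventually (gt_mem_nhds one_pos)
  refine MeasureTheory.tendsto_integral_filter_of_dominated_convergence
    (fun u => (‖C‖ + 1) * 2 ^ β * Real.exp (-(A / 2) * u ^ 2)) ?_ ?_ ?_ ?_
  · filter_upwards [hpos] with t ht
    have hc : Continuous (g t) := by
      have := continuous_vertical hF ht
      exact (this.mul (by fun_prop)).div_const _
    exact ((hc.measurable.indicator measurableSet_Icc).comp
      (measurable_const_mul (t * √t))).aestronglyMeasurable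
  · have hb := hnear.norm.eventually (gt_mem_nhds (show ‖C‖ < ‖C‖ + 1 by linarith))
    filter_upwards [hpos, eventually_sector hb] with t ht hbt
    refine .of_forall fun u => ?_
    by_cases hu : t * √t * u ∈ Set.Icc (-t) t
    · rw [Set.indicator_of_mem hu, hg]
      beta_reduce
      rw [normalized_integrand ht, norm_mul, norm_mul]
      have hv : |√t * u| ≤ 1 := by
        have h1 : t * |√t * u| ≤ t * 1 := by
          have := abs_le.mpr hu
          rw [mul_assoc, abs_mul, abs_of_pos ht] at this
          linarith
        exact le_of_mul_le_mul_left h1 ht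
      have hv2 : (√t * u) ^ 2 ≤ 1 := by
        rw [← sq_abs]; nlinarith [abs_nonneg (√t * u)]
      gcongr
      · refine (hbt _ (by simp) ?_).le
        simpa using abs_le.mpr hu
      · rw [Complex.norm_cpow_real]
        refine Real.rpow_le_rpow (norm_nonneg _) ?_ hβ
        refine (norm_add_le _ _).trans ?_
        rw [norm_mul, norm_I, norm_real, norm_one, Real.norm_eq_abs]
        linarith
      · rw [Complex.norm_exp]
        refine Real.exp_le_exp.mpr ?_
        have : ((-(A * u ^ 2) : ℂ) / (1 + (√t * u : ℝ) * I)).re =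
            -(A * u ^ 2) / (1 + (√t * u) ^ 2) := by
          rw [show (-(A * u ^ 2) : ℂ) = ((-(A * u ^ 2) : ℝ) : ℂ) by push_cast; ring, div_re]
          simp [normSq_apply, -ofReal_mul, -ofReal_neg, -ofReal_pow]
          ring
        rw [this, neg_div, neg_mul, neg_le_neg_iff, le_div_iff₀ (by positivity)]
        have : 0 ≤ A * u ^ 2 := by positivity
        nlinarith
    · rw [Set.indicator_of_notMem hu, norm_zero]
      positivity
  · exact (integrable_exp_neg_mul_sq (by positivity)).const_mul _
  · refine .of_forall fun u => ?_
    have hform : ∀ᶠ t : ℝ in 𝓝[>] 0,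
        F (t + (t * √t * u : ℝ) * I) /
          ((t + (t * √t * u : ℝ) * I) ^ (β : ℂ) * cexp (A / (t + (t * √t * u : ℝ) * I))) *
        (1 + (√t * u : ℝ) * I) ^ (β : ℂ) * cexp (-(A * u ^ 2) / (1 + (√t * u : ℝ) * I)) =
        (Set.Icc (-t) t).indicator (g t) (t * √t * u) := by
      filter_upwards [hpos, hsmall u] with t ht hu
      rw [Set.indicator_of_mem, hg]
      · beta_reduce
        rw [normalized_integrand ht]
      · rw [Set.mem_Icc, ← abs_le, mul_assoc, abs_mul, abs_of_pos ht]
        nlinarith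
    refine Tendsto.congr' hform ?_
    have hsec : Tendsto (fun t : ℝ => (t + (t * √t * u : ℝ) * I : ℂ)) (𝓝[>] 0) sectorFilter := by
      refine tendsto_sector (by simpa using! tendsto_id) ?_
      filter_upwards [hpos, hsmall u] with t ht hu
      simp only [add_im, ofReal_im, mul_im, I_im, mul_one, I_re, add_re, ofReal_re, mul_re, zero_add,
        mul_zero, sub_zero, add_zero]
      rw [mul_assoc, abs_mul, abs_of_pos ht]
      nlinarith
    have hw : Tendsto (fun t : ℝ => (1 + (√t * u : ℝ) * I : ℂ)) (𝓝[>] 0) (𝓝 1) := by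
      have h1 : Tendsto (fun t : ℝ => ((√t * u : ℝ) : ℂ)) (𝓝[>] 0) (𝓝 ((0 * u : ℝ) : ℂ)) :=
        (Complex.continuous_ofReal.tendsto _).comp (hsqrt.mul_const u)
      simpa using (h1.mul_const I).const_add 1
    have h2 : Tendsto (fun t : ℝ => (1 + (√t * u : ℝ) * I : ℂ) ^ (β : ℂ)) (𝓝[>] 0) (𝓝 1) := by
      have h := (continuousAt_cpow_const (b := (β : ℂ)) (a := 1) (by simp)).tendsto.comp hw
      simpa [Function.comp_def] using h
    have h3 : Tendsto (fun t : ℝ => cexp (-(A * u ^ 2) / (1 + (√t * u : ℝ) * I))) (𝓝[>] 0)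
        (𝓝 (Real.exp (-A * u ^ 2) : ℂ)) := by
      have h := (Complex.continuous_exp.tendsto _).comp
        ((tendsto_const_nhds (x := (-(A * u ^ 2) : ℂ))).div hw one_ne_zero)
      simpa [Function.comp_def, Pi.div_def] using h
    simpa [Function.comp_def] using ((hnear.comp hsec).mul h2).mul h3

/-- Saddle-point asymptotics for the Cauchy integral with singularity `z ^ β * exp (A / z)`. -/
lemma tendsto_full_integral {a : ℕ → ℝ} {F : ℂ → ℂ} {A β ε : ℝ} {C : ℂ} (hA : 0 < A) (hβ : 0 ≤ β)
    (hε : 0 < ε)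
    (hF : ∀ z : ℂ, 0 < z.re → HasSum (fun n : ℕ => (a n : ℂ) * cexp (-(n * z))) (F z))
    (hnear : Tendsto (fun z => F z / (z ^ (β : ℂ) * cexp (A / z))) sectorFilter (𝓝 C))
    (hfar : ∀ᶠ t : ℝ in 𝓝[>] 0, ∀ θ : ℝ, t ≤ |θ| → |θ| ≤ π →
      ‖F (t + θ * I)‖ ≤ ‖F t‖ * Real.exp (-(ε / t))) :
    Tendsto (fun t : ℝ => ((t * √t : ℝ) : ℂ)⁻¹ * ∫ θ in (-π)..π,
      F (t + θ * I) * cexp (A / t ^ 2 * (t + θ * I)) / ((t : ℂ) ^ (β : ℂ) * cexp (2 * A / t)))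
      (𝓝[>] 0) (𝓝 (C * (√(π / A) : ℝ))) := by
  set g : ℝ → ℝ → ℂ := fun t θ =>
    F (t + θ * I) * cexp (A / t ^ 2 * (t + θ * I)) / ((t : ℂ) ^ (β : ℂ) * cexp (2 * A / t)) with hg
  have hpos : ∀ᶠ t : ℝ in 𝓝[>] 0, 0 < t := eventually_mem_nhdsWithin
  have hlt : ∀ᶠ t : ℝ in 𝓝[>] 0, t < π :=
    (gt_mem_nhds Real.pi_pos).filter_mono nhdsWithin_le_nhds
  have hsplit : ∀ᶠ t : ℝ in 𝓝[>] 0,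
      ((t * √t : ℝ) : ℂ)⁻¹ * (∫ θ in Set.Icc (-t) t, g t θ) +
        ((t * √t : ℝ) : ℂ)⁻¹ * (∫ θ in Set.Icc (-π) π \ Set.Icc (-t) t, g t θ) =
      ((t * √t : ℝ) : ℂ)⁻¹ * ∫ θ in (-π)..π, g t θ := by
    filter_upwards [hpos, hlt] with t ht htπ
    have hc : Continuous (g t) :=
      ((continuous_vertical hF ht).mul (by fun_prop)).div_const _
    rw [intervalIntegral.integral_of_le (by linarith [Real.pi_pos]),
      ← MeasureTheory.integral_Icc_eq_integral_Ioc, ← mul_add,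
      MeasureTheory.setIntegral_sdiff measurableSet_Icc
        (hc.continuousOn.integrableOn_compact isCompact_Icc)
        (Set.Icc_subset_Icc (by linarith) htπ.le)]
    ring
  refine Tendsto.congr' hsplit ?_
  suffices hfar0 : Tendsto (fun t : ℝ => ((t * √t : ℝ) : ℂ)⁻¹ *
      ∫ θ in Set.Icc (-π) π \ Set.Icc (-t) t, g t θ) (𝓝[>] 0) (𝓝 0) by
    simpa using (tendsto_near_integral hA hβ hF hnear).add hfar0
  have hb := hnear.norm.eventually (gt_mem_nhds (show ‖C‖ < ‖C‖ + 1 by linarith))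
  have hexp : Tendsto (fun t : ℝ => (‖C‖ + 1) * (2 * π) * ((t * √t)⁻¹ * Real.exp (-(ε / t))))
      (𝓝[>] 0) (𝓝 0) := by
    have h1 := ((tendsto_rpow_mul_exp_neg_mul_atTop_nhds_zero (3 / 2) ε hε).comp
      (tendsto_inv_nhdsGT_zero (𝕜 := ℝ))).const_mul ((‖C‖ + 1) * (2 * π))
    rw [mul_zero] at h1
    refine h1.congr' ?_
    filter_upwards [hpos] with t ht
    have : (t⁻¹ : ℝ) ^ (3 / 2 : ℝ) = (t * √t)⁻¹ := by
      rw [Real.inv_rpow ht.le, show (3 / 2 : ℝ) = 1 + 1 / 2 by norm_num, Real.rpow_add ht,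
        Real.rpow_one, ← Real.sqrt_eq_rpow]
    simp only [Function.comp_apply, this]
    ring_nf
  refine squeeze_zero_norm' ?_ hexp
  filter_upwards [hpos, hlt, hfar, eventually_sector hb] with t ht htπ hft hbt
  have hs := Real.sqrt_pos.mpr ht
  have hF0 : ‖F t‖ ≤ (‖C‖ + 1) * (t ^ β * Real.exp (A / t)) := by
    have := hbt t (by simp) (by simpa using ht.le)
    rw [norm_div, norm_mul, Complex.norm_cpow_real, norm_real, Complex.norm_exp, ← ofReal_div,
      ofReal_re, Real.norm_of_nonneg ht.le, div_lt_iff₀ (by positivity)] at this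
    exact this.le
  have hbound : ∀ θ ∈ Set.Icc (-π) π \ Set.Icc (-t) t,
      ‖g t θ‖ ≤ (‖C‖ + 1) * Real.exp (-(ε / t)) := by
    rintro θ ⟨h1, h2⟩
    have h1' := abs_le.mpr h1
    have h2' : t ≤ |θ| := by
      by_contra h
      exact h2 (abs_le.mp (not_le.mp h).le)
    have h3 : ‖cexp (A / t ^ 2 * (t + θ * I))‖ = Real.exp (A / t) := by
      rw [Complex.norm_exp]
      congr 1
      rw [show (A / t ^ 2 * (t + θ * I) : ℂ) = ((A / t ^ 2 : ℝ) : ℂ) * (t + θ * I) by push_cast; ring,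
        re_ofReal_mul]
      simp
      field_simp
    have h4 : ‖cexp (2 * A / t)‖ = Real.exp (A / t) * Real.exp (A / t) := by
      rw [Complex.norm_exp, ← Real.exp_add]
      congr 1
      rw [show (2 * A / t : ℂ) = ((2 * A / t : ℝ) : ℂ) by push_cast; ring, ofReal_re]
      ring
    rw [hg, norm_div, norm_mul, norm_mul, h3, h4, Complex.norm_cpow_real, norm_real,
      Real.norm_of_nonneg ht.le, div_le_iff₀ (by positivity)]
    calc ‖F (t + θ * I)‖ * Real.exp (A / t)
        ≤ ((‖C‖ + 1) * (t ^ β * Real.exp (A / t)) * Real.exp (-(ε / t))) * Real.exp (A / t) := by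
          gcongr
          exact (hft θ h2' h1').trans (by gcongr)
      _ = _ := by ring
  have hvol : MeasureTheory.volume.real (Set.Icc (-π) π \ Set.Icc (-t) t) ≤ 2 * π := by
    refine (MeasureTheory.measureReal_mono Set.sdiff_subset (by simp)).trans ?_
    simp [Real.pi_pos.le]
    linarith
  have hint := MeasureTheory.norm_setIntegral_le_of_norm_le_const
    (lt_of_le_of_lt (MeasureTheory.measure_mono Set.sdiff_subset)
      (by simp : MeasureTheory.volume (Set.Icc (-π) π) < ⊤)) hbound
  rw [norm_mul, norm_inv, norm_real, Real.norm_of_nonneg (by positivity)]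
  calc (t * √t)⁻¹ * ‖∫ θ in Set.Icc (-π) π \ Set.Icc (-t) t, g t θ‖
      ≤ (t * √t)⁻¹ * (((‖C‖ + 1) * Real.exp (-(ε / t))) * (2 * π)) := by
        gcongr
        exact hint.trans (by gcongr)
    _ = _ := by ring

/-- Coefficient asymptotics of a power series behaving like `C * z ^ β * exp (A / z)` at
`q = exp (-z) → 1` and exponentially smaller away from `1`. -/
theorem tendsto_coeff {a : ℕ → ℝ} {F : ℂ → ℂ} {A β ε C : ℝ} (hA : 0 < A) (hβ : 0 ≤ β)
    (hε : 0 < ε)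
    (hF : ∀ z : ℂ, 0 < z.re → HasSum (fun n : ℕ => (a n : ℂ) * cexp (-(n * z))) (F z))
    (hnear : Tendsto (fun z => F z / (z ^ (β : ℂ) * cexp (A / z))) sectorFilter (𝓝 (C : ℂ)))
    (hfar : ∀ᶠ t : ℝ in 𝓝[>] 0, ∀ θ : ℝ, t ≤ |θ| → |θ| ≤ π →
      ‖F (t + θ * I)‖ ≤ ‖F t‖ * Real.exp (-(ε / t))) :
    Tendsto (fun n : ℕ => a n / ((√(A / n)) ^ (β + 3 / 2) * Real.exp (2 * √(A * n))))
      atTop (𝓝 (C * √(π / A) / (2 * π))) := by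
  have htn : Tendsto (fun n : ℕ => √(A / n)) atTop (𝓝[>] 0) := by
    refine tendsto_nhdsWithin_iff.mpr ⟨?_, ?_⟩
    · have h := (Real.continuous_sqrt.tendsto 0).comp (tendsto_const_div_atTop_nhds_zero_nat A)
      simpa [Function.comp_def] using h
    · filter_upwards [eventually_gt_atTop 0] with n hn
      have : (0 : ℝ) < n := by exact_mod_cast hn
      exact Real.sqrt_pos.mpr (by positivity)
  have h := ((tendsto_full_integral hA hβ hε hF hnear hfar).comp htn).div_const (2 * π : ℂ)
  have h' := (Complex.continuous_re.tendsto _).comp h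
  have hlim : ((C : ℂ) * (√(π / A) : ℝ) / (2 * π)).re = C * √(π / A) / (2 * π) := by
    exact_mod_cast ofReal_re (C * √(π / A) / (2 * π))
  rw [hlim] at h'
  refine h'.congr' ?_
  filter_upwards [eventually_gt_atTop 0] with n hn
  have hn' : (0 : ℝ) < n := by exact_mod_cast hn
  have ht : 0 < √(A / n) := Real.sqrt_pos.mpr (by positivity)
  simp only [Function.comp_apply]
  set t := √(A / n) with htdef
  have ht2 : t ^ 2 = A / n := Real.sq_sqrt (by positivity)
  have hAn : A / t ^ 2 = n := by rw [ht2]; field_simp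
  have hAnC : (A / t ^ 2 : ℂ) = n := by exact_mod_cast congrArg ofReal hAn
  have hAt : A / t = √(A * n) := by
    rw [eq_comm, Real.sqrt_eq_iff_eq_sq (by positivity) (by positivity), div_pow, ht2]
    field_simp
  rw [intervalIntegral.integral_div, hAnC, integral_mul_exp_eq_coeff hF ht n]
  have h1 : (t : ℂ) ^ (β : ℂ) = ((t ^ β : ℝ) : ℂ) := (ofReal_cpow ht.le β).symm
  have h2 : cexp (2 * A / t) = (Real.exp (2 * √(A * n)) : ℂ) := by
    rw [← hAt]
    push_cast
    ring_nf
  have h3 : t ^ (β + 3 / 2) = t ^ β * (t * √t) := by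
    rw [show β + 3 / 2 = β + (1 + 1 / 2) by norm_num, Real.rpow_add ht, Real.rpow_add ht,
      Real.rpow_one, ← Real.sqrt_eq_rpow]
  rw [h1, h2, h3]
  have hval : (((t * √t : ℝ) : ℂ)⁻¹ * (2 * π * a n /
      (((t ^ β : ℝ) : ℂ) * (Real.exp (2 * √(A * n)) : ℂ))) / (2 * π)) =
      ((a n / (t ^ β * (t * √t) * Real.exp (2 * √(A * n))) : ℝ) : ℂ) := by
    have : (π : ℂ) ≠ 0 := by exact_mod_cast Real.pi_ne_zero
    push_cast
    field_simp
  rw [hval, ofReal_re]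

/-- Euler's product `∏ (1 - q ^ (n + 1))`. -/
def eulerProd (q : ℂ) : ℂ := ∏' n : ℕ, (1 - q ^ (n + 1))

/-- The product `∏ (1 + q ^ (2 n + 1))`. -/
def oddProd (q : ℂ) : ℂ := ∏' n : ℕ, (1 + q ^ (2 * n + 1))

lemma multipliable_one_add_odd {q : ℂ} (hq : ‖q‖ < 1) :
    Multipliable fun n : ℕ => 1 + q ^ (2 * n + 1) := by
  apply multipliable_one_add_of_summable
  have h := (summable_geometric_of_lt_one (norm_nonneg _) hq).comp_injective
    (i := fun n : ℕ => 2 * n + 1) (fun a b h => by simpa using h)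
  simpa [Function.comp_def] using h

lemma multipliable_one_sub_odd {q : ℂ} (hq : ‖q‖ < 1) :
    Multipliable fun n : ℕ => 1 - q ^ (2 * n + 1) := by
  have h := multipliable_one_add_odd (q := -q) (by simpa using hq)
  refine h.congr fun n => ?_
  rw [Odd.neg_pow ⟨n, rfl⟩, sub_eq_add_neg]

lemma norm_pow_lt_one {q : ℂ} (hq : ‖q‖ < 1) {k : ℕ} (hk : k ≠ 0) : ‖q ^ k‖ < 1 := by
  rw [norm_pow]
  exact pow_lt_one₀ (norm_nonneg _) hq hk

lemma eulerProd_ne_zero {q : ℂ} (hq : ‖q‖ < 1) : eulerProd q ≠ 0 := by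
  have := tprod_one_add_ne_zero_of_summable (f := fun n : ℕ => -q ^ (n + 1)) (fun n h => ?_) ?_
  · simpa [eulerProd, sub_eq_add_neg] using this
  · have h1 : q ^ (n + 1) = 1 := by linear_combination -h
    exact absurd (norm_pow_lt_one hq (Nat.succ_ne_zero n)) (by simp [h1])
  · simpa using (summable_nat_add_iff 1).mpr (summable_geometric_of_lt_one (norm_nonneg _) hq)

lemma odd_mul_even {q : ℂ} (hq : ‖q‖ < 1) :
    (∏' n : ℕ, (1 - q ^ (2 * n + 1))) * eulerProd (q ^ 2) = eulerProd q := by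
  have h := tprod_even_mul_odd (f := fun n : ℕ => 1 - q ^ (n + 1)) (multipliable_one_sub_odd hq) ?_
  · rw [eulerProd, eulerProd, ← h]
    congr 1
    refine tprod_congr fun n => ?_
    rw [← pow_mul]
    ring_nf
  · refine (ModularForm.multipliable_one_sub_pow
      (norm_pow_lt_one hq (two_ne_zero))).congr fun n => ?_
    rw [← pow_mul]
    ring_nf

/-- The odd product is a quotient of Euler products. -/
lemma oddProd_eq {q : ℂ} (hq : ‖q‖ < 1) :
    oddProd q = eulerProd (q ^ 2) ^ 2 / (eulerProd q * eulerProd (q ^ 4)) := by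
  have hq2 : ‖q ^ 2‖ < 1 := norm_pow_lt_one hq two_ne_zero
  have h1 := odd_mul_even hq
  have h2 := odd_mul_even hq2
  have h3 : oddProd q * (∏' n : ℕ, (1 - q ^ (2 * n + 1))) = ∏' n : ℕ, (1 - (q ^ 2) ^ (2 * n + 1)) := by
    rw [oddProd, ← (multipliable_one_add_odd hq).tprod_mul (multipliable_one_sub_odd hq)]
    refine tprod_congr fun n => ?_
    rw [← pow_mul]
    ring
  rw [← pow_mul] at h2
  have n1 := eulerProd_ne_zero hq
  have n4 := eulerProd_ne_zero (norm_pow_lt_one hq (four_ne_zero))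
  rw [eq_div_iff (mul_ne_zero n1 n4), ← h1]
  norm_num at h2
  linear_combination (eulerProd (q ^ 2) * eulerProd (q ^ 4)) * h3 + eulerProd (q ^ 2) * h2

lemma norm_exp_neg_lt_one {z : ℂ} (hz : 0 < z.re) : ‖cexp (-z)‖ < 1 := by
  rw [Complex.norm_exp]
  simpa using hz

lemma eta_mul_I {w : ℂ} :
    ModularForm.eta (w * I) = cexp (-(π * w / 12)) * eulerProd (cexp (-(2 * π * w))) := by
  rw [ModularForm.eta, eulerProd]
  congr 1
  · rw [Function.Periodic.qParam]
    congr 1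
    push_cast
    linear_combination (2 * π * w / 24) * I_sq
  · refine tprod_congr fun n => ?_
    rw [ModularForm.eta_q_eq_pow]
    congr 3
    linear_combination (2 * π * w) * I_sq

/-- The modular transformation of Euler's product. -/
lemma eulerProd_modular {z : ℂ} (hz : 0 < z.re) :
    cexp (-(π ^ 2 / (6 * z))) * eulerProd (cexp (-(4 * π ^ 2 / z))) =
      (z / (2 * π)) ^ (1 / 2 : ℂ) * (cexp (-(z / 24)) * eulerProd (cexp (-z))) := by
  have hπ : (π : ℂ) ≠ 0 := by exact_mod_cast Real.pi_ne_zero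
  have hz0 : z ≠ 0 := fun h => by simp [h] at hz
  set w : ℂ := z / (2 * π) with hw
  have hwre : 0 < w.re := by
    rw [hw, show (2 * π : ℂ) = ((2 * π : ℝ) : ℂ) by push_cast; ring, div_ofReal_re]
    have := Real.pi_pos
    positivity
  have hw0 : w ≠ 0 := fun h => by simp [h] at hwre
  have h := ModularForm.eta_comp_eq_csqrt_I_inv (x := w * I) (by
    change 0 < (w * I).im
    simpa using hwre)
  have hinv : -1 / (w * I) = w⁻¹ * I := by
    field_simp
    rw [I_sq]
  have hsqrt : (w * I) ^ (2⁻¹ : ℂ) = w ^ (2⁻¹ : ℂ) * I ^ (2⁻¹ : ℂ) := by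
    rw [cpow_def_of_ne_zero (mul_ne_zero hw0 I_ne_zero), cpow_def_of_ne_zero hw0,
      cpow_def_of_ne_zero I_ne_zero, ← Complex.exp_add, ← add_mul, Complex.log_mul hw0 I_ne_zero]
    have harg := abs_lt.mp (Complex.abs_arg_lt_pi_div_two_iff.mpr (Or.inl hwre))
    rw [arg_I]
    constructor <;> linarith [harg.1, harg.2, Real.pi_pos]
  have hI : I ^ (2⁻¹ : ℂ) ≠ 0 := by simp [cpow_eq_zero_iff]
  simp only [Function.comp_apply, Pi.smul_apply, Pi.mul_apply, smul_eq_mul, Complex.sqrt, hinv,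
    eta_mul_I, hsqrt] at h
  rw [show (1 / 2 : ℂ) = 2⁻¹ by norm_num]
  have e1 : (π * w⁻¹ / 12 : ℂ) = π ^ 2 / (6 * z) := by rw [hw]; field_simp; norm_num
  have e2 : (2 * π * w⁻¹ : ℂ) = 4 * π ^ 2 / z := by rw [hw]; field_simp; norm_num
  have e3 : (π * w / 12 : ℂ) = z / 24 := by rw [hw]; field_simp; norm_num
  have e4 : (2 * π * w : ℂ) = z := by rw [hw]; field_simp
  rw [e1, e2, e3, e4] at h
  rw [h]
  field_simp

lemma sector_re_pos : ∀ᶠ z in sectorFilter, 0 < z.re := by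
  rw [sectorFilter]
  refine Eventually.filter_mono inf_le_left ?_
  exact (eventually_mem_nhdsWithin (a := (0 : ℝ)) (s := Set.Ioi 0)).comap re

lemma sector_tendsto_zero : Tendsto (fun z : ℂ => z) sectorFilter (𝓝 0) := by
  have hre : Tendsto re sectorFilter (𝓝 0) :=
    (tendsto_comap.mono_left inf_le_left).mono_right nhdsWithin_le_nhds
  have hb : ∀ᶠ z in sectorFilter, ‖z‖ ≤ 2 * z.re := by
    have h2 : ∀ᶠ z in sectorFilter, |z.im| ≤ z.re :=
      Eventually.filter_mono inf_le_right (eventually_principal.mpr fun z hz => hz)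
    filter_upwards [sector_re_pos, h2] with z h1 h2
    refine (norm_le_abs_re_add_abs_im z).trans ?_
    rw [abs_of_pos h1]
    linarith
  exact squeeze_zero_norm' hb (by simpa using hre.const_mul 2)

lemma sector_inv_re_atTop : Tendsto (fun z : ℂ => (z⁻¹).re) sectorFilter atTop := by
  have hre : Tendsto re sectorFilter (𝓝[>] 0) := tendsto_comap.mono_left inf_le_left
  have h := (tendsto_inv_nhdsGT_zero.comp hre).const_mul_atTop (show (0 : ℝ) < 1 / 2 by norm_num)
  refine tendsto_atTop_mono' _ ?_ h
  have h2 : ∀ᶠ z in sectorFilter, |z.im| ≤ z.re :=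
    Eventually.filter_mono inf_le_right (eventually_principal.mpr fun z hz => hz)
  filter_upwards [sector_re_pos, h2] with z h1 h2
  have h3 : z.im ^ 2 ≤ z.re ^ 2 := sq_le_sq.mpr (by rwa [abs_of_pos h1])
  simp only [Function.comp_apply, inv_re, normSq_apply]
  rw [le_div_iff₀ (by nlinarith [mul_pos h1 h1, mul_self_nonneg z.im])]
  field_simp
  nlinarith

lemma tendsto_eulerProd_zero : Tendsto eulerProd (𝓝 0) (𝓝 1) := by
  have h := (ModularForm.differentiableOn_tprod_one_sub_pow.differentiableAt
    (Metric.isOpen_ball.mem_nhds (Metric.mem_ball_self one_pos))).continuousAt.tendsto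
  simpa [eulerProd] using! h

/-- Asymptotics of the partition generating function near `q = 1`. -/
lemma tendsto_inv_eulerProd : Tendsto
    (fun z : ℂ => (eulerProd (cexp (-z)))⁻¹ / (z ^ (1 / 2 : ℂ) * cexp (π ^ 2 / (6 * z))))
    sectorFilter (𝓝 ((2 * π : ℂ) ^ (1 / 2 : ℂ))⁻¹) := by
  have h1 : Tendsto (fun z : ℂ => cexp (-(4 * π ^ 2 / z))) sectorFilter (𝓝 0) := by
    rw [tendsto_zero_iff_norm_tendsto_zero]
    have h := Real.tendsto_exp_neg_atTop_nhds_zero.comp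
      (sector_inv_re_atTop.const_mul_atTop (show 0 < 4 * π ^ 2 by positivity))
    refine h.congr fun z => ?_
    rw [Complex.norm_exp, Function.comp_apply]
    congr 1
    rw [neg_re, div_eq_mul_inv, show (4 * π ^ 2 : ℂ) = ((4 * π ^ 2 : ℝ) : ℂ) by push_cast; ring,
      re_ofReal_mul]
  have h2 := (tendsto_eulerProd_zero.comp h1).inv₀ one_ne_zero
  have h3 : Tendsto (fun z : ℂ => cexp (-(z / 24))) sectorFilter (𝓝 1) := by
    have h := (Complex.continuous_exp.tendsto _).comp (sector_tendsto_zero.div_const 24).neg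
    simpa [Function.comp_def] using h
  have h4 := (h2.mul h3).mul_const ((2 * π : ℂ) ^ (1 / 2 : ℂ))⁻¹
  simp only [inv_one, one_mul] at h4
  refine h4.congr' ?_
  filter_upwards [sector_re_pos] with z hz
  have hmod := eulerProd_modular hz
  have hz0 : z ≠ 0 := fun h => by simp [h] at hz
  have hsq : z ^ (1 / 2 : ℂ) = (2 * π : ℂ) ^ (1 / 2 : ℂ) * (z / (2 * π)) ^ (1 / 2 : ℂ) := by
    have h := ofReal_mul_cpow (t := 2 * π) (by positivity) (w := z / (2 * π))
      (div_ne_zero hz0 (by simp)) (1 / 2)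
    push_cast at h
    rw [← h]
    congr 1
    field_simp
  have hzpow : (z / (2 * π)) ^ (1 / 2 : ℂ) ≠ 0 := by simp [cpow_eq_zero_iff, hz0]
  have hpipow : (2 * π : ℂ) ^ (1 / 2 : ℂ) ≠ 0 := by simp [cpow_eq_zero_iff]
  have hq1 := eulerProd_ne_zero (norm_exp_neg_lt_one hz)
  have hE : eulerProd (cexp (-(4 * π ^ 2 / z))) = cexp (π ^ 2 / (6 * z)) *
      ((z / (2 * π)) ^ (1 / 2 : ℂ) * (cexp (-(z / 24)) * eulerProd (cexp (-z)))) := by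
    rw [← hmod, ← mul_assoc, ← Complex.exp_add]
    simp
  have n1 := Complex.exp_ne_zero (π ^ 2 / (6 * z))
  have n2 := Complex.exp_ne_zero (-(z / 24))
  rw [hsq, Function.comp_apply, hE]
  generalize cexp (π ^ 2 / (6 * z)) = a at *
  generalize cexp (-(z / 24)) = b at *
  generalize eulerProd (cexp (-z)) = e at *
  generalize (z / (2 * π)) ^ (1 / 2 : ℂ) = u at *
  generalize (2 * π : ℂ) ^ (1 / 2 : ℂ) = v at *
  field_simp

lemma tendsto_mul_sector {k : ℝ} (hk : 0 < k) :
    Tendsto (fun z : ℂ => (k : ℂ) * z) sectorFilter sectorFilter := by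
  have hre : Tendsto re sectorFilter (𝓝[>] 0) := tendsto_comap.mono_left inf_le_left
  refine tendsto_inf.mpr ⟨tendsto_comap_iff.mpr ?_, tendsto_principal.mpr ?_⟩
  · refine tendsto_nhdsWithin_iff.mpr ⟨?_, ?_⟩
    · simpa [Function.comp_def] using (tendsto_nhdsWithin_iff.mp hre).1.const_mul k
    · filter_upwards [sector_re_pos] with z hz
      simpa using mul_pos hk hz
  · have h2 : ∀ᶠ z in sectorFilter, |z.im| ≤ z.re :=
      Eventually.filter_mono inf_le_right (eventually_principal.mpr fun z hz => hz)
    filter_upwards [h2] with z hz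
    simp only [re_ofReal_mul, im_ofReal_mul, abs_mul, abs_of_pos hk]
    exact mul_le_mul_of_nonneg_left hz hk.le

/-- Asymptotics of `∏ (1 + q ^ (2 n + 1))` near `q = 1`. -/
lemma tendsto_oddProd : Tendsto
    (fun z : ℂ => oddProd (cexp (-z)) / (z ^ ((0 : ℝ) : ℂ) * cexp ((π ^ 2 / 24 : ℝ) / z)))
    sectorFilter (𝓝 ((1 : ℝ) : ℂ)) := by
  have hL : ((2 * π : ℂ) ^ (1 / 2 : ℂ))⁻¹ ≠ 0 := by simp [cpow_eq_zero_iff]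
  have h1 := tendsto_inv_eulerProd
  have h2 := h1.comp (tendsto_mul_sector (k := 2) two_pos)
  have h4 := h1.comp (tendsto_mul_sector (k := 4) four_pos)
  have h := (h1.mul h4).div (h2.pow 2) (pow_ne_zero 2 hL)
  rw [← pow_two, div_self (pow_ne_zero 2 hL)] at h
  rw [ofReal_one]
  refine h.congr' ?_
  filter_upwards [sector_re_pos] with z hz
  have hz0 : z ≠ 0 := fun h => by simp [h] at hz
  have e2 : cexp (-((2 : ℝ) * z)) = cexp (-z) ^ 2 := by
    rw [← Complex.exp_nat_mul]
    congr 1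
    push_cast
    ring
  have e4 : cexp (-((4 : ℝ) * z)) = cexp (-z) ^ 4 := by
    rw [← Complex.exp_nat_mul]
    congr 1
    push_cast
    ring
  have hq := norm_exp_neg_lt_one hz
  have p2 := ofReal_mul_cpow (t := 2) two_pos hz0 (1 / 2)
  have p4 := ofReal_mul_cpow (t := 4) four_pos hz0 (1 / 2)
  have hk : ((4 : ℝ) : ℂ) ^ (1 / 2 : ℂ) = (((2 : ℝ) : ℂ) ^ (1 / 2 : ℂ)) ^ 2 := by
    rw [show ((4 : ℝ) : ℂ) = ((2 : ℝ) : ℂ) * ((2 : ℝ) : ℂ) by push_cast; norm_num,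
      ofReal_mul_cpow two_pos (by simp), pow_two]
  have x1 : cexp (π ^ 2 / (6 * z)) = cexp (π ^ 2 / (6 * ((2 : ℝ) * z))) ^ 2 := by
    rw [← Complex.exp_nat_mul]
    congr 1
    push_cast
    field_simp
  have x2 : cexp (π ^ 2 / (6 * ((4 : ℝ) * z))) = cexp ((π ^ 2 / 24 : ℝ) / z) := by
    congr 1
    push_cast
    field_simp
    norm_num
  have n1 := eulerProd_ne_zero hq
  have n2 := eulerProd_ne_zero (norm_pow_lt_one hq two_ne_zero)
  have n4 := eulerProd_ne_zero (norm_pow_lt_one hq four_ne_zero)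
  have m1 := Complex.exp_ne_zero (π ^ 2 / (6 * ((2 : ℝ) * z)))
  have m2 := Complex.exp_ne_zero ((π ^ 2 / 24 : ℝ) / z)
  have m3 : z ^ (1 / 2 : ℂ) ≠ 0 := by simp [cpow_eq_zero_iff, hz0]
  have m4 : ((2 : ℝ) : ℂ) ^ (1 / 2 : ℂ) ≠ 0 := by simp [cpow_eq_zero_iff]
  simp only [Function.comp_apply, Pi.div_apply]
  rw [oddProd_eq hq, e2, e4, p2, p4, hk, x1, x2, ofReal_zero, cpow_zero]
  generalize cexp (π ^ 2 / (6 * ((2 : ℝ) * z))) = a at *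
  generalize cexp ((π ^ 2 / 24 : ℝ) / z) = b at *
  generalize eulerProd (cexp (-z)) = u at *
  generalize eulerProd (cexp (-z) ^ 2) = v at *
  generalize eulerProd (cexp (-z) ^ 4) = w at *
  generalize z ^ (1 / 2 : ℂ) = x at *
  generalize ((2 : ℝ) : ℂ) ^ (1 / 2 : ℂ) = y at *
  field_simp

lemma norm_tprod_le {f g : ℕ → ℂ} {d : ℕ → ℝ} (hf : Multipliable f) (hg : Multipliable g)
    (hd : Summable d) (h : ∀ n, ‖f n‖ ≤ ‖g n‖ * Real.exp (-d n)) :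
    ‖∏' n, f n‖ ≤ ‖∏' n, g n‖ * Real.exp (-∑' n, d n) := by
  have h1 := hf.hasProd.tendsto_prod_nat.norm
  have h2 := hg.hasProd.tendsto_prod_nat.norm.mul
    ((Real.continuous_exp.tendsto _).comp hd.hasSum.tendsto_sum_nat.neg)
  refine le_of_tendsto_of_tendsto' h1 h2 fun n => ?_
  rw [Function.comp_apply, ← Finset.sum_neg_distrib, Real.exp_sum, norm_prod, norm_prod,
    ← Finset.prod_mul_distrib]
  exact Finset.prod_le_prod (fun _ _ => norm_nonneg _) fun i _ => h i

lemma norm_one_add_le {w : ℂ} (hw : ‖w‖ < 1) :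
    ‖1 + w‖ ≤ ‖(1 + ‖w‖ : ℂ)‖ * Real.exp (-((‖w‖ - w.re) / 8)) := by
  have hre := (abs_le.mp (abs_re_le_norm w))
  have h0 := norm_nonneg w
  have hE : ‖(1 + ‖w‖ : ℂ)‖ = 1 + ‖w‖ := by
    rw [← ofReal_one, ← ofReal_add, norm_real, Real.norm_of_nonneg (by positivity)]
  rw [hE]
  refine le_of_sq_le_sq ?_ (by positivity)
  have hs : ‖1 + w‖ ^ 2 = (1 + ‖w‖) ^ 2 - 2 * (‖w‖ - w.re) := by
    have h1 := Complex.sq_norm (1 + w)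
    have h2 := Complex.sq_norm w
    rw [normSq_apply] at h1 h2
    simp only [add_re, one_re, add_im, one_im] at h1
    linarith
  rw [hs, mul_pow, ← Real.exp_nat_mul]
  have he := Real.add_one_le_exp (-((‖w‖ - w.re) / 2))
  have he2 : Real.exp (-((‖w‖ - w.re) / 2)) ≤
      Real.exp ((2 : ℕ) * -((‖w‖ - w.re) / 8)) := by
    apply Real.exp_le_exp.mpr
    push_cast
    linarith [hre.2]
  have h3 := mul_le_mul_of_nonneg_left (he.trans he2) (sq_nonneg (1 + ‖w‖))
  nlinarith [hre.2, mul_nonneg (sub_nonneg.mpr hre.2) h0,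
    mul_nonneg (sub_nonneg.mpr hre.2) (sub_nonneg.mpr hw.le),
    mul_nonneg (mul_nonneg (sub_nonneg.mpr hre.2) (sub_nonneg.mpr hw.le)) h0]

lemma norm_inv_one_sub_le {w : ℂ} (hw : ‖w‖ < 1) :
    ‖(1 - w)⁻¹‖ ≤ ‖((1 - ‖w‖ : ℂ))⁻¹‖ * Real.exp (-((‖w‖ - w.re) / 8)) := by
  have hre := (abs_le.mp (abs_re_le_norm w))
  have h0 := norm_nonneg w
  have hE : ‖(1 - ‖w‖ : ℂ)‖ = 1 - ‖w‖ := by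
    rw [← ofReal_one, ← ofReal_sub, norm_real, Real.norm_of_nonneg (by linarith)]
  have hpos : 0 < 1 - ‖w‖ := by linarith
  have hs : ‖1 - w‖ ^ 2 = (1 - ‖w‖) ^ 2 + 2 * (‖w‖ - w.re) := by
    have h1 := Complex.sq_norm (1 - w)
    have h2 := Complex.sq_norm w
    rw [normSq_apply] at h1 h2
    simp only [sub_re, one_re, sub_im, one_im] at h1
    linarith
  have hpos' : 0 < ‖1 - w‖ := by
    rw [norm_pos_iff, sub_ne_zero]
    rintro rfl
    simp at hw
  rw [norm_inv, norm_inv, hE, Real.exp_neg, ← mul_inv]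
  refine inv_anti₀ (by positivity) ?_
  refine le_of_sq_le_sq ?_ hpos'.le
  rw [hs, mul_pow, ← Real.exp_nat_mul]
  set x := ‖w‖ - w.re with hx
  have hx0 : 0 ≤ x := by linarith [hre.2]
  have hx2 : x ≤ 2 := by linarith [hre.1]
  have he : Real.exp ((2 : ℕ) * (x / 8)) ≤ 1 + 2 * x := by
    have h4 := Real.add_one_le_exp (-(x / 4))
    rw [show ((2 : ℕ) * (x / 8) : ℝ) = -(-(x / 4)) by push_cast; ring, Real.exp_neg]
    rw [inv_le_comm₀ (Real.exp_pos _) (by positivity)]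
    refine le_trans ?_ h4
    rw [inv_le_iff_one_le_mul₀ (by positivity)]
    nlinarith
  have h5 := mul_le_mul_of_nonneg_left he (sq_nonneg (1 - ‖w‖))
  have h6 : (1 - ‖w‖) ^ 2 ≤ 1 := by nlinarith
  nlinarith

/-- The closed form of `∑ (‖q‖ ^ (2 n + 1) - Re q ^ (2 n + 1))`. -/
lemma hasSum_odd_defect {q : ℂ} (hq : ‖q‖ < 1) :
    HasSum (fun n : ℕ => ‖q ^ (2 * n + 1)‖ - (q ^ (2 * n + 1)).re)
      (‖q‖ / (1 - ‖q‖ ^ 2) - (q / (1 - q ^ 2)).re) := by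
  have h1 : HasSum (fun n : ℕ => ‖q ^ (2 * n + 1)‖) (‖q‖ / (1 - ‖q‖ ^ 2)) := by
    have h := (hasSum_geometric_of_lt_one (sq_nonneg ‖q‖)
      (pow_lt_one₀ (norm_nonneg _) hq two_ne_zero)).mul_left ‖q‖
    simpa only [norm_mul, norm_pow, pow_succ' _ (2 * _), pow_mul, div_eq_mul_inv] using h
  have h2 : HasSum (fun n : ℕ => q ^ (2 * n + 1)) (q / (1 - q ^ 2)) := by
    have h := (hasSum_geometric_of_norm_lt_one (norm_pow_lt_one hq two_ne_zero)).mul_left q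
    simpa only [pow_succ' _ (2 * _), pow_mul, div_eq_mul_inv] using h
  exact h1.sub (hasSum_re h2)

lemma odd_defect_lower_bound {q : ℂ} {t : ℝ} (ht : 0 < t) (ht1 : t ≤ 1)
    (hq : ‖q‖ = Real.exp (-t)) (hy : 0 < q.re → 4 / 90 * t ^ 2 ≤ q.im ^ 2) :
    1 / (160 * t) ≤ ‖q‖ / (1 - ‖q‖ ^ 2) - (q / (1 - q ^ 2)).re := by
  have hr1 : ‖q‖ < 1 := by rw [hq]; simpa using ht
  have hr3 : 1 / 3 ≤ ‖q‖ := by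
    have h1 : Real.exp (-1) ≤ Real.exp (-t) := Real.exp_le_exp.mpr (by linarith)
    have h2 : (1 / 3 : ℝ) ≤ Real.exp (-1) := by
      rw [Real.exp_neg, one_div]
      exact inv_anti₀ (Real.exp_pos 1) (by linarith [Real.exp_one_lt_d9])
    rw [hq]
    linarith
  have hrsq : ‖q‖ ^ 2 = q.re * q.re + q.im * q.im := by rw [Complex.sq_norm, normSq_apply]
  have hxr := re_le_norm q
  have hm : 0 < 1 - ‖q‖ ^ 2 := by nlinarith [norm_nonneg q]
  have hm2 : 1 - ‖q‖ ^ 2 ≤ 2 * t := by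
    rw [hq, ← Real.exp_nat_mul]
    have := Real.add_one_le_exp ((2 : ℕ) * -t)
    push_cast at this ⊢
    linarith
  have hre : (q / (1 - q ^ 2)).re =
      (1 - ‖q‖ ^ 2) * q.re / ((1 - ‖q‖ ^ 2) ^ 2 + 4 * q.im ^ 2) := by
    have hn : normSq (1 - q ^ 2) = (1 - ‖q‖ ^ 2) ^ 2 + 4 * q.im ^ 2 := by
      rw [hrsq, normSq_apply]
      simp [pow_two]
      ring
    rw [div_re, hn, ← add_div, hrsq]
    congr 1
    simp [pow_two]
    ring
  rw [hre]
  set r := ‖q‖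
  set m := 1 - r ^ 2
  have hrm : 1 / (6 * t) ≤ r / m := by
    rw [div_le_div_iff₀ (by positivity) hm]
    nlinarith
  have hb : m * q.re / (m ^ 2 + 4 * q.im ^ 2) ≤ 90 / 94 * (r / m) := by
    rcases le_or_gt q.re 0 with hx | hx
    · have h1 : m * q.re / (m ^ 2 + 4 * q.im ^ 2) ≤ 0 :=
        div_nonpos_of_nonpos_of_nonneg (by nlinarith) (by positivity)
      have h2 : 0 ≤ 90 / 94 * (r / m) := by positivity
      linarith
    · have hy' := hy hx
      rw [← mul_div_assoc, div_le_div_iff₀ (by positivity) hm]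
      have h3 : m ^ 2 ≤ 4 * t ^ 2 := by nlinarith
      have h4 : 94 * m ^ 2 ≤ 90 * (m ^ 2 + 4 * q.im ^ 2) := by nlinarith
      have h5 : m ^ 2 * q.re ≤ m ^ 2 * r := mul_le_mul_of_nonneg_left hxr (sq_nonneg m)
      have h6 : 94 * m ^ 2 * r ≤ 90 * (m ^ 2 + 4 * q.im ^ 2) * r :=
        mul_le_mul_of_nonneg_right h4 (norm_nonneg q)
      nlinarith
  have h7 : 1 / (160 * t) ≤ 4 / 94 * (1 / (6 * t)) := by
    rw [← mul_div_assoc, div_le_div_iff₀ (by positivity) (by positivity)]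
    linarith
  linarith

lemma norm_exp_neg_add {t θ : ℝ} : ‖cexp (-(t + θ * I))‖ = Real.exp (-t) := by
  rw [Complex.norm_exp]
  simp

/-- Away from the positive real axis the total defect of the odd powers is of order `1 / t`. -/
lemma le_tsum_odd_defect {t θ : ℝ} (ht : 0 < t) (ht1 : t ≤ 1) (hθ : t ≤ |θ|) (hπ : |θ| ≤ π) :
    1 / (160 * t) ≤ ∑' n : ℕ, (‖cexp (-(t + θ * I)) ^ (2 * n + 1)‖ -
      (cexp (-(t + θ * I)) ^ (2 * n + 1)).re) := by
  have hq : ‖cexp (-(t + θ * I))‖ = Real.exp (-t) := norm_exp_neg_add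
  have hq1 : ‖cexp (-(t + θ * I))‖ < 1 := by rw [hq]; simpa using ht
  rw [(hasSum_odd_defect hq1).tsum_eq]
  refine odd_defect_lower_bound ht ht1 hq fun hx => ?_
  have hre : (cexp (-(t + θ * I))).re = Real.exp (-t) * Real.cos θ := by
    rw [Complex.exp_re]
    simp
  have him : (cexp (-(t + θ * I))).im = -(Real.exp (-t) * Real.sin θ) := by
    rw [Complex.exp_im]
    simp
  rw [hre] at hx
  rw [him]
  have hcos : 0 < Real.cos θ := pos_of_mul_pos_right hx (Real.exp_pos _).le
  have hθ2 : |θ| ≤ π / 2 := by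
    by_contra! hcon
    have := Real.cos_nonpos_of_pi_div_two_le_of_le hcon.le (by linarith [Real.pi_pos])
    rw [Real.cos_abs] at this
    linarith
  have hsin := Real.mul_abs_le_abs_sin hθ2
  have hr3 : 1 / 3 ≤ Real.exp (-t) := by
    have h1 : Real.exp (-1) ≤ Real.exp (-t) := Real.exp_le_exp.mpr (by linarith)
    have h2 : (1 / 3 : ℝ) ≤ Real.exp (-1) := by
      rw [Real.exp_neg, one_div]
      exact inv_anti₀ (Real.exp_pos 1) (by linarith [Real.exp_one_lt_d9])
    linarith
  have hπ10 : π ^ 2 ≤ 10 := by nlinarith [Real.pi_lt_d2, Real.pi_pos]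
  have h1 : (2 / π * t) ^ 2 ≤ Real.sin θ ^ 2 := by
    rw [← sq_abs (Real.sin θ)]
    refine pow_le_pow_left₀ (by positivity) (le_trans ?_ hsin) 2
    exact mul_le_mul_of_nonneg_left hθ (by positivity)
  have h2 : 4 / 10 * t ^ 2 ≤ (2 / π * t) ^ 2 := by
    rw [mul_pow, div_pow]
    refine mul_le_mul_of_nonneg_right ?_ (sq_nonneg t)
    norm_num
    rw [div_le_div_iff₀ (by norm_num) (by positivity)]
    linarith
  have h3 : (1 / 9 : ℝ) ≤ Real.exp (-t) ^ 2 := by nlinarith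
  rw [neg_sq, mul_pow]
  nlinarith [mul_le_mul h3 (h2.trans h1) (by positivity) (by positivity)]

lemma defect_nonneg (w : ℂ) : 0 ≤ ‖w‖ - w.re := sub_nonneg.mpr (re_le_norm w)

lemma ofReal_exp_neg_pow (t θ : ℝ) (k : ℕ) :
    cexp (-t) ^ k = ((‖cexp (-(t + θ * I)) ^ k‖ : ℝ) : ℂ) := by
  rw [norm_pow, norm_exp_neg_add]
  push_cast
  rfl

lemma far_oddProd : ∀ᶠ t : ℝ in 𝓝[>] 0, ∀ θ : ℝ, t ≤ |θ| → |θ| ≤ π →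
    ‖oddProd (cexp (-(t + θ * I)))‖ ≤ ‖oddProd (cexp (-t))‖ * Real.exp (-(1 / 1280 / t)) := by
  filter_upwards [Ioc_mem_nhdsGT one_pos] with t ht θ hθ hπ
  have hq : ‖cexp (-(t + θ * I))‖ < 1 := by rw [norm_exp_neg_add]; simpa using ht.1
  have hr : ‖cexp (-t)‖ < 1 := norm_exp_neg_lt_one (by simpa using ht.1)
  have hs := (hasSum_odd_defect hq).summable.div_const 8
  refine (norm_tprod_le (multipliable_one_add_odd hq) (multipliable_one_add_odd hr) hs
    fun n => ?_).trans ?_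
  · rw [ofReal_exp_neg_pow t θ]
    exact norm_one_add_le (norm_pow_lt_one hq (Nat.succ_ne_zero _))
  · refine mul_le_mul_of_nonneg_left (Real.exp_le_exp.mpr (neg_le_neg ?_)) (norm_nonneg _)
    rw [tsum_div_const]
    have h := le_tsum_odd_defect ht.1 ht.2 hθ hπ
    have e : 1 / 1280 / t = 1 / (160 * t) / 8 := by field_simp; norm_num
    rw [e]
    linarith

lemma summable_defect {q : ℂ} (hq : ‖q‖ < 1) :
    Summable fun n : ℕ => ‖q ^ (n + 1)‖ - (q ^ (n + 1)).re := by
  have h1 := (summable_nat_add_iff (f := fun n => q ^ n) 1).mpr (summable_geometric_of_norm_lt_one hq)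
  have h2 := (summable_nat_add_iff (f := fun n => ‖q‖ ^ n) 1).mpr
    (summable_geometric_of_lt_one (norm_nonneg _) hq)
  simp only [norm_pow]
  exact h2.sub (hasSum_re h1.hasSum).summable

lemma far_inv_eulerProd : ∀ᶠ t : ℝ in 𝓝[>] 0, ∀ θ : ℝ, t ≤ |θ| → |θ| ≤ π →
    ‖(eulerProd (cexp (-(t + θ * I))))⁻¹‖ ≤
      ‖(eulerProd (cexp (-t)))⁻¹‖ * Real.exp (-(1 / 1280 / t)) := by
  filter_upwards [Ioc_mem_nhdsGT one_pos] with t ht θ hθ hπ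
  have hq : ‖cexp (-(t + θ * I))‖ < 1 := by rw [norm_exp_neg_add]; simpa using ht.1
  have hr : ‖cexp (-t)‖ < 1 := norm_exp_neg_lt_one (by simpa using ht.1)
  have hsum := summable_defect hq
  have hinv {q : ℂ} (hq : ‖q‖ < 1) : HasProd (fun n : ℕ => (1 - q ^ (n + 1))⁻¹) (eulerProd q)⁻¹ :=
    (ModularForm.multipliable_one_sub_pow hq).hasProd.inv₀ (eulerProd_ne_zero hq)
  rw [← (hinv hq).tprod_eq, ← (hinv hr).tprod_eq]
  refine (norm_tprod_le (hinv hq).multipliable (hinv hr).multipliable (hsum.div_const 8)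
    fun n => ?_).trans ?_
  · rw [ofReal_exp_neg_pow t θ]
    exact norm_inv_one_sub_le (norm_pow_lt_one hq (Nat.succ_ne_zero _))
  · refine mul_le_mul_of_nonneg_left (Real.exp_le_exp.mpr (neg_le_neg ?_)) (norm_nonneg _)
    rw [tsum_div_const]
    have h := le_tsum_odd_defect ht.1 ht.2 hθ hπ
    have h' := tsum_comp_le_tsum_of_inj hsum
      (fun n => defect_nonneg _) (i := fun n : ℕ => 2 * n) (fun a b h => by simpa using h)
    have e : 1 / 1280 / t = 1 / (160 * t) / 8 := by field_simp; norm_num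
    rw [e]
    simp only [Function.comp_def] at h'
    linarith

lemma hasSum_coeff_mul {f g : PowerSeries ℕ} {q u v : ℂ}
    (hf : HasSum (fun n : ℕ => ((PowerSeries.coeff n f : ℕ) : ℂ) * q ^ n) u)
    (hg : HasSum (fun n : ℕ => ((PowerSeries.coeff n g : ℕ) : ℂ) * q ^ n) v) :
    HasSum (fun n : ℕ => ((PowerSeries.coeff n (f * g) : ℕ) : ℂ) * q ^ n) (u * v) := by
  have hc : ∀ n : ℕ, ((PowerSeries.coeff n (f * g) : ℕ) : ℂ) * q ^ n =
      ∑ kl ∈ Finset.HasAntidiagonal.antidiagonal n, (((PowerSeries.coeff kl.1 f : ℕ) : ℂ) * q ^ kl.1) *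
        (((PowerSeries.coeff kl.2 g : ℕ) : ℂ) * q ^ kl.2) := by
    intro n
    rw [PowerSeries.coeff_mul]
    push_cast
    rw [Finset.sum_mul]
    refine Finset.sum_congr rfl fun kl hkl => ?_
    rw [← Finset.HasAntidiagonal.mem_antidiagonal.mp hkl, pow_add]
    ring
  simp only [hc]
  rw [← hf.tsum_eq, ← hg.tsum_eq, tsum_mul_tsum_eq_tsum_sum_antidiagonal_of_summable_norm
    hf.summable.norm hg.summable.norm]
  exact (summable_norm_sum_mul_antidiagonal_of_summable_norm
    hf.summable.norm hg.summable.norm).of_norm.hasSum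

lemma hasSum_coeff_prod {g : ℕ → PowerSeries ℕ} {q : ℂ} {φ : ℕ → ℂ}
    (hg : ∀ i, HasSum (fun n : ℕ => ((PowerSeries.coeff n (g i) : ℕ) : ℂ) * q ^ n) (φ i)) (m : ℕ) :
    HasSum (fun n : ℕ => ((PowerSeries.coeff n (∏ i ∈ Finset.range m, g i) : ℕ) : ℂ) * q ^ n)
      (∏ i ∈ Finset.range m, φ i) := by
  induction m with
  | zero =>
    have h := hasSum_single (f := fun n : ℕ =>
      ((PowerSeries.coeff n (1 : PowerSeries ℕ) : ℕ) : ℂ) * q ^ n) 0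
      (fun n hn => by simp [PowerSeries.coeff_one, hn])
    simpa using h
  | succ m ih =>
    rw [Finset.prod_range_succ, Finset.prod_range_succ]
    exact hasSum_coeff_mul ih (hg m)

lemma monotone_coeff_prod {g : ℕ → PowerSeries ℕ} (hg : ∀ i, PowerSeries.coeff 0 (g i) = 1)
    (n : ℕ) : Monotone fun m => PowerSeries.coeff n (∏ i ∈ Finset.range m, g i) := by
  refine monotone_nat_of_le_succ fun m => ?_
  rw [Finset.prod_range_succ, PowerSeries.coeff_mul]
  have h := Finset.single_le_sum (f := fun kl : ℕ × ℕ =>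
      PowerSeries.coeff kl.1 (∏ i ∈ Finset.range m, g i) * PowerSeries.coeff kl.2 (g m))
    (s := Finset.HasAntidiagonal.antidiagonal n) (fun _ _ => Nat.zero_le _) (a := (n, 0)) (by simp)
  simpa [hg] using h

/-- An infinite product of power series with natural coefficients, whose coefficients stabilize to
`a`, evaluates in the unit disc to the product of the values. -/
lemma hasSum_of_coeff_prod {g : ℕ → PowerSeries ℕ} {a : ℕ → ℕ} {φ : ℕ → ℂ → ℂ} {Φ : ℂ → ℂ}
    (hg : ∀ i, PowerSeries.coeff 0 (g i) = 1)
    (hφ : ∀ q : ℂ, ‖q‖ < 1 → ∀ i,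
      HasSum (fun n : ℕ => ((PowerSeries.coeff n (g i) : ℕ) : ℂ) * q ^ n) (φ i q))
    (ha : ∀ n, ∀ᶠ m in atTop, PowerSeries.coeff n (∏ i ∈ Finset.range m, g i) = a n)
    (hΦ : ∀ q : ℂ, ‖q‖ < 1 → HasProd (fun i => φ i q) (Φ q)) {q : ℂ} (hq : ‖q‖ < 1) :
    HasSum (fun n : ℕ => (a n : ℂ) * q ^ n) (Φ q) := by
  have hle : ∀ m n, PowerSeries.coeff n (∏ i ∈ Finset.range m, g i) ≤ a n := by
    intro m n
    obtain ⟨k, hk, hmk⟩ := ((ha n).and (eventually_ge_atTop m)).exists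
    rw [← hk]
    exact monotone_coeff_prod hg n hmk
  set r : ℝ := ‖q‖
  have hr0 : 0 ≤ r := norm_nonneg q
  have hr : ‖(r : ℂ)‖ < 1 := by rwa [norm_real, Real.norm_of_nonneg hr0]
  have hsum : Summable fun n : ℕ => (a n : ℝ) * r ^ n := by
    refine summable_of_sum_range_le (c := (Φ r).re) (fun n => by positivity) fun N => ?_
    have hlim := (continuous_re.tendsto _).comp (hΦ r hr).tendsto_prod_nat
    refine ge_of_tendsto hlim ?_
    have hev : ∀ᶠ m in atTop, ∀ n ∈ Finset.range N,
        PowerSeries.coeff n (∏ i ∈ Finset.range m, g i) = a n :=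
      (Finset.eventually_all _).mpr fun n _ => ha n
    filter_upwards [hev] with m hm
    have hs := hasSum_re (hasSum_coeff_prod (hφ r hr) m)
    have hre : ∀ n : ℕ, (((PowerSeries.coeff n (∏ i ∈ Finset.range m, g i) : ℕ) : ℂ) * (r : ℂ) ^ n).re =
        ((PowerSeries.coeff n (∏ i ∈ Finset.range m, g i) : ℕ) : ℝ) * r ^ n := by
      intro n
      rw [← ofReal_pow, ← ofReal_natCast, ← ofReal_mul, ofReal_re]
    simp only [hre] at hs
    rw [Function.comp_apply]
    refine le_trans (Finset.sum_le_sum fun n hn => ?_)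
      (sum_le_hasSum (Finset.range N) (fun n _ => by positivity) hs)
    rw [hm n hn]
  have hnorm : Summable fun n : ℕ => ‖(a n : ℂ) * q ^ n‖ := by
    simpa [norm_mul, norm_pow] using hsum
  have hlim : Tendsto (fun m => ∑' n : ℕ,
      ((PowerSeries.coeff n (∏ i ∈ Finset.range m, g i) : ℕ) : ℂ) * q ^ n) atTop
      (𝓝 (∑' n : ℕ, (a n : ℂ) * q ^ n)) := by
    refine tendsto_tsum_of_dominated_convergence hsum (fun n => ?_) (Eventually.of_forall ?_)
    · refine tendsto_const_nhds.congr' ?_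
      filter_upwards [ha n] with m hm
      rw [hm]
    · intro m n
      rw [norm_mul, norm_pow, norm_natCast]
      exact mul_le_mul_of_nonneg_right (by exact_mod_cast hle m n) (by positivity)
  simp only [fun m => (hasSum_coeff_prod (hφ q hq) m).tsum_eq] at hlim
  rw [tendsto_nhds_unique (hΦ q hq).tendsto_prod_nat hlim]
  exact hnorm.of_norm.hasSum

/-- The series `∑ X ^ (k j)`, the generating function of partitions into copies of `k`. -/
def multiplesSeries (k : ℕ) : PowerSeries ℕ := PowerSeries.mk fun n => if k ∣ n then 1 else 0

open PowerSeries.WithPiTopology in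
lemma eventually_coeff_prod_multiplesSeries (n : ℕ) : ∀ᶠ m in atTop,
    PowerSeries.coeff n (∏ i ∈ Finset.range m, multiplesSeries (i + 1)) =
      Fintype.card (Nat.Partition n) := by
  have h := (Nat.Partition.hasProd_powerSeriesMk_card_restricted ℕ fun _ => True).tendsto_prod_nat
  have hfac : ∀ i : ℕ, (∑' j : ℕ, (PowerSeries.X : PowerSeries ℕ) ^ ((i + 1) * j)) =
      multiplesSeries (i + 1) := by
    intro i
    refine HasSum.tsum_eq ?_
    rw [PowerSeries.WithPiTopology.hasSum_iff_hasSum_coeff]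
    intro d
    simp only [multiplesSeries, PowerSeries.coeff_mk, PowerSeries.coeff_X_pow]
    split_ifs with hd
    · obtain ⟨j, rfl⟩ := hd
      convert! hasSum_ite_eq j (1 : ℕ) using 2 with j'
      simp [eq_comm]
    · convert! hasSum_zero using 2 with j
      rw [if_neg]
      rintro rfl
      exact hd (dvd_mul_right _ _)
  simp only [if_true, hfac] at h
  rw [PowerSeries.WithPiTopology.tendsto_iff_coeff_tendsto] at h
  have hn := h n
  rw [nhds_discrete, tendsto_pure] at hn
  filter_upwards [hn] with m hm
  rw [hm]
  simp [Nat.Partition.restricted, Finset.card_univ]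

lemma hasSum_multiplesSeries {q : ℂ} (hq : ‖q‖ < 1) (k : ℕ) :
    HasSum (fun n : ℕ => ((PowerSeries.coeff n (multiplesSeries (k + 1)) : ℕ) : ℂ) * q ^ n)
      (1 - q ^ (k + 1))⁻¹ := by
  have h := hasSum_geometric_of_norm_lt_one (norm_pow_lt_one hq (Nat.succ_ne_zero k))
  have hinj : Function.Injective fun j : ℕ => (k + 1) * j :=
    fun a b h => by simpa using h
  rw [← hinj.hasSum_iff]
  · simpa [Function.comp_def, multiplesSeries, pow_mul] using h
  · intro n hn
    have : ¬ (k + 1) ∣ n := fun ⟨j, hj⟩ => hn ⟨j, hj.symm⟩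
    simp [multiplesSeries, this]

/-- Euler's generating function for partitions. -/
lemma hasSum_card_partition {q : ℂ} (hq : ‖q‖ < 1) :
    HasSum (fun n : ℕ => (Fintype.card (Nat.Partition n) : ℂ) * q ^ n) (eulerProd q)⁻¹ :=
  hasSum_of_coeff_prod (g := fun i => multiplesSeries (i + 1))
    (φ := fun i q => (1 - q ^ (i + 1))⁻¹) (Φ := fun q => (eulerProd q)⁻¹)
    (fun i => by simp [multiplesSeries]) (fun q hq i => hasSum_multiplesSeries hq i)
    eventually_coeff_prod_multiplesSeries
    (fun q hq => (ModularForm.multipliable_one_sub_pow hq).hasProd.inv₀ (eulerProd_ne_zero hq)) hq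

/-- Self-conjugate Young diagrams with `n` cells and fewer than `m + 1` columns. -/
def selfConjDiagrams (m n : ℕ) : Set YoungDiagram :=
  {μ | μ.transpose = μ ∧ (0, m) ∉ μ ∧ μ.card = n}

lemma swap_mem_of_transpose_eq {μ : YoungDiagram} (h : μ.transpose = μ) {i j : ℕ} :
    (i, j) ∈ μ ↔ (j, i) ∈ μ := by
  conv_lhs => rw [← h, YoungDiagram.mem_transpose]
  rfl

lemma lt_of_mem_of_transpose_eq {μ : YoungDiagram} (h : μ.transpose = μ) {m i j : ℕ}
    (hm : (0, m) ∉ μ) (hij : (i, j) ∈ μ) : i < m ∧ j < m := by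
  have key : ∀ {i j : ℕ}, (i, j) ∈ μ → j < m := fun {i j} hij => by
    by_contra! hcon
    exact hm (μ.up_left_mem (Nat.zero_le i) hcon hij)
  exact ⟨key ((swap_mem_of_transpose_eq h).mp hij), key hij⟩

/-- Adjoin to a Young diagram a hook whose arm and leg have length `m`. -/
def addHook (m : ℕ) (μ : YoungDiagram) : YoungDiagram where
  cells := (Finset.range (m + 1) ×ˢ Finset.range (m + 1)).filter
    fun x => x.1 = 0 ∨ x.2 = 0 ∨ (x.1 - 1, x.2 - 1) ∈ μ
  isLowerSet := by
    rintro ⟨i, j⟩ ⟨i', j'⟩ ⟨hi, hj⟩ h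
    simp only [Finset.coe_filter, Finset.mem_product, Finset.mem_range, Set.mem_ofPred_eq] at h ⊢
    simp only at hi hj
    refine ⟨by omega, ?_⟩
    by_cases h1 : i' = 0
    · exact Or.inl h1
    by_cases h2 : j' = 0
    · exact Or.inr (Or.inl h2)
    refine Or.inr (Or.inr (μ.up_left_mem (i2 := i - 1) (j2 := j - 1) (by omega) (by omega) ?_))
    rcases h.2 with h | h | h
    · omega
    · omega
    · exact h

lemma mem_addHook {m : ℕ} {μ : YoungDiagram} {i j : ℕ} : (i, j) ∈ addHook m μ ↔
    (i ≤ m ∧ j ≤ m) ∧ (i = 0 ∨ j = 0 ∨ (i - 1, j - 1) ∈ μ) := by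
  rw [← YoungDiagram.mem_cells, addHook]
  simp

/-- Remove the first row and the first column of a Young diagram. -/
def strip (μ : YoungDiagram) : YoungDiagram where
  cells := μ.cells.filter fun x => (x.1 + 1, x.2 + 1) ∈ μ
  isLowerSet := by
    rintro ⟨i, j⟩ ⟨i', j'⟩ ⟨hi, hj⟩ h
    simp only [Finset.coe_filter, YoungDiagram.mem_cells, Set.mem_ofPred_eq] at h ⊢
    exact ⟨μ.up_left_mem hi hj h.1, μ.up_left_mem (Nat.succ_le_succ hi) (Nat.succ_le_succ hj) h.2⟩

lemma mem_strip {μ : YoungDiagram} {i j : ℕ} : (i, j) ∈ strip μ ↔ (i + 1, j + 1) ∈ μ := by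
  rw [← YoungDiagram.mem_cells, strip]
  simp only [Finset.mem_filter, YoungDiagram.mem_cells, and_iff_right_iff_imp]
  exact μ.up_left_mem (Nat.le_succ _) (Nat.le_succ _)

lemma diagram_ext {μ ν : YoungDiagram} (h : ∀ i j, (i, j) ∈ μ ↔ (i, j) ∈ ν) : μ = ν :=
  SetLike.ext fun x => h x.1 x.2

lemma strip_addHook {m : ℕ} {μ : YoungDiagram} (h : μ.transpose = μ) (hm : (0, m) ∉ μ) :
    strip (addHook m μ) = μ := by
  refine diagram_ext fun i j => ?_
  rw [mem_strip, mem_addHook]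
  refine ⟨fun hij => by simpa using hij.2, fun hij => ?_⟩
  have := lt_of_mem_of_transpose_eq h hm hij
  exact ⟨⟨this.1, this.2⟩, by simpa using hij⟩

lemma addHook_strip {m : ℕ} {μ : YoungDiagram} (h : μ.transpose = μ) (hm : (0, m + 1) ∉ μ)
    (hm' : (0, m) ∈ μ) : addHook m (strip μ) = μ := by
  refine diagram_ext fun i j => ?_
  rw [mem_addHook, mem_strip]
  constructor
  · rintro ⟨⟨hi, hj⟩, rfl | rfl | h3⟩
    · exact μ.up_left_mem le_rfl hj hm'
    · exact (swap_mem_of_transpose_eq h).mp (μ.up_left_mem le_rfl hi hm')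
    · rcases i with _ | i
      · exact μ.up_left_mem le_rfl hj hm'
      rcases j with _ | j
      · exact (swap_mem_of_transpose_eq h).mp (μ.up_left_mem le_rfl hi hm')
      exact h3
  · intro hij
    have := lt_of_mem_of_transpose_eq h hm hij
    refine ⟨⟨by omega, by omega⟩, ?_⟩
    rcases i with _ | i
    · exact Or.inl rfl
    rcases j with _ | j
    · exact Or.inr (Or.inl rfl)
    exact Or.inr (Or.inr hij)

lemma transpose_addHook {m : ℕ} {μ : YoungDiagram} (h : μ.transpose = μ) :
    (addHook m μ).transpose = addHook m μ := by
  refine diagram_ext fun i j => ?_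
  rw [YoungDiagram.mem_transpose, Prod.swap_prod_mk, mem_addHook, mem_addHook,
    swap_mem_of_transpose_eq h]
  tauto

lemma transpose_strip {μ : YoungDiagram} (h : μ.transpose = μ) :
    (strip μ).transpose = strip μ := by
  refine diagram_ext fun i j => ?_
  rw [YoungDiagram.mem_transpose, Prod.swap_prod_mk, mem_strip, mem_strip,
    swap_mem_of_transpose_eq h]

lemma card_addHook {m : ℕ} {μ : YoungDiagram} (h : μ.transpose = μ) (hm : (0, m) ∉ μ) :
    (addHook m μ).card = μ.card + (2 * m + 1) := by
  have hcells : (addHook m μ).cells = μ.cells.image (fun x => (x.1 + 1, x.2 + 1)) ∪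
      ((Finset.range (m + 1)).image (fun j => (0, j)) ∪
        (Finset.range m).image (fun i => (i + 1, 0))) := by
    ext ⟨i, j⟩
    rw [YoungDiagram.mem_cells, mem_addHook]
    simp only [Finset.mem_union, Finset.mem_image, Prod.mk.injEq, Finset.mem_range, Prod.exists,
      YoungDiagram.mem_cells]
    constructor
    · rintro ⟨⟨hi, hj⟩, h3⟩
      rcases i with _ | i
      · exact Or.inr (Or.inl ⟨j, by omega, rfl, rfl⟩)
      rcases j with _ | j
      · exact Or.inr (Or.inr ⟨i, by omega, rfl, rfl⟩)
      exact Or.inl ⟨i, j, by simpa using h3, rfl, rfl⟩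
    · rintro (⟨a, b, hab, rfl, rfl⟩ | ⟨a, ha, rfl, rfl⟩ | ⟨a, ha, rfl, rfl⟩)
      · have := lt_of_mem_of_transpose_eq h hm hab
        exact ⟨⟨this.1, this.2⟩, by simpa using hab⟩
      · exact ⟨⟨by omega, by omega⟩, Or.inl rfl⟩
      · exact ⟨⟨by omega, by omega⟩, Or.inr (Or.inl rfl)⟩
  change (addHook m μ).cells.card = μ.cells.card + (2 * m + 1)
  rw [hcells, Finset.card_union_of_disjoint, Finset.card_union_of_disjoint,
    Finset.card_image_of_injective, Finset.card_image_of_injective,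
    Finset.card_image_of_injective, Finset.card_range, Finset.card_range]
  · ring
  · exact fun x y hxy => by simpa using hxy
  · exact fun x y hxy => by simpa using hxy
  · exact fun x y hxy => by simpa [Prod.ext_iff] using hxy
  · rw [Finset.disjoint_left]
    rintro ⟨i, j⟩ h1 h2
    simp only [Finset.mem_image, Prod.mk.injEq] at h1 h2
    obtain ⟨a, -, rfl, -⟩ := h1
    obtain ⟨b, -, hb, -⟩ := h2
    omega
  · rw [Finset.disjoint_left]
    rintro ⟨i, j⟩ h1 h2
    simp only [Finset.mem_union, Finset.mem_image, Prod.mk.injEq] at h1 h2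
    obtain ⟨a, -, rfl, rfl⟩ := h1
    rcases h2 with ⟨b, -, hb, -⟩ | ⟨b, -, -, hb⟩ <;> omega

lemma selfConjDiagrams_zero (n : ℕ) :
    selfConjDiagrams 0 n = if n = 0 then {⊥} else ∅ := by
  have hbot : ∀ {μ : YoungDiagram}, (0, 0) ∉ μ → μ = ⊥ := fun {μ} hμ =>
    diagram_ext fun i j => by
      simp only [YoungDiagram.notMem_bot, iff_false]
      exact fun hij => hμ (μ.up_left_mem (Nat.zero_le _) (Nat.zero_le _) hij)
  split_ifs with hn
  · subst hn
    refine Set.eq_singleton_iff_unique_mem.mpr ⟨⟨diagram_ext fun i j => ?_, ?_, rfl⟩, ?_⟩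
    · simp
    · simp
    · exact fun μ hμ => hbot hμ.2.1
  · refine Set.eq_empty_iff_forall_notMem.mpr fun μ hμ => hn ?_
    rw [← hμ.2.2, hbot hμ.2.1]
    rfl

lemma selfConjDiagrams_succ (m n : ℕ) :
    selfConjDiagrams (m + 1) n = selfConjDiagrams m n ∪
      (if 2 * m + 1 ≤ n then addHook m '' selfConjDiagrams m (n - (2 * m + 1)) else ∅) := by
  ext μ
  constructor
  · rintro ⟨h1, h2, h3⟩
    by_cases hm : (0, m) ∈ μ
    · right
      have hs : (0, m) ∉ strip μ := by
        rw [mem_strip]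
        exact fun h => h2 (μ.up_left_mem (Nat.zero_le _) le_rfl h)
      have hc := card_addHook (transpose_strip h1) hs
      rw [addHook_strip h1 h2 hm, h3] at hc
      rw [if_pos (by omega)]
      exact ⟨strip μ, ⟨transpose_strip h1, hs, by omega⟩, addHook_strip h1 h2 hm⟩
    · exact Or.inl ⟨h1, hm, h3⟩
  · rintro (⟨h1, h2, h3⟩ | h)
    · exact ⟨h1, fun h => h2 (μ.up_left_mem le_rfl (Nat.le_succ m) h), h3⟩
    · split_ifs at h with hn
      · obtain ⟨ν, ⟨h1, h2, h3⟩, rfl⟩ := h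
        refine ⟨transpose_addHook h1, ?_, ?_⟩
        · rw [mem_addHook]
          omega
        · rw [card_addHook h1 h2]
          omega
      · exact h.elim

lemma ncard_selfConjDiagrams (m : ℕ) : ∀ n, (selfConjDiagrams m n).Finite ∧
    (selfConjDiagrams m n).ncard =
      PowerSeries.coeff n (∏ k ∈ Finset.range m, (1 + PowerSeries.X ^ (2 * k + 1) :
        PowerSeries ℕ)) := by
  induction m with
  | zero =>
    intro n
    rw [selfConjDiagrams_zero, Finset.prod_range_zero, PowerSeries.coeff_one]
    split_ifs <;> simp
  | succ m ih =>
    intro n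
    rw [selfConjDiagrams_succ, Finset.prod_range_succ, mul_add, mul_one, map_add,
      PowerSeries.coeff_mul_X_pow', ← (ih n).2]
    split_ifs with hn
    · have hfin := (ih (n - (2 * m + 1))).1.image (addHook m)
      refine ⟨(ih n).1.union hfin, ?_⟩
      have hinj : Set.InjOn (addHook m) (selfConjDiagrams m (n - (2 * m + 1))) := by
        intro μ hμ ν hν hμν
        rw [← strip_addHook hμ.1 hμ.2.1, hμν, strip_addHook hν.1 hν.2.1]
      have hdisj : Disjoint (selfConjDiagrams m n)
          (addHook m '' selfConjDiagrams m (n - (2 * m + 1))) := by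
        rw [Set.disjoint_left]
        rintro _ hμ ⟨ν, -, rfl⟩
        exact hμ.2.1 (mem_addHook.mpr ⟨⟨Nat.zero_le _, le_rfl⟩, Or.inl rfl⟩)
      rw [Set.ncard_union_eq hdisj (ih n).1 hfin, hinj.ncard_image, (ih (n - (2 * m + 1))).2]
    · simpa using (ih n).1

lemma rowLen_zero_le_card (μ : YoungDiagram) : μ.rowLen 0 ≤ μ.card := by
  rw [YoungDiagram.rowLen_eq_card]
  exact Finset.card_le_card (Finset.filter_subset _ _)

lemma selfConjDiagrams_of_le {m n : ℕ} (h : n ≤ m) :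
    selfConjDiagrams m n = {μ | μ.transpose = μ ∧ μ.card = n} := by
  ext μ
  refine ⟨fun hμ => ⟨hμ.1, hμ.2.2⟩, fun hμ => ⟨hμ.1, fun hm => ?_, hμ.2⟩⟩
  have h1 := rowLen_zero_le_card μ
  rw [hμ.2] at h1
  rw [YoungDiagram.mem_iff_lt_rowLen] at hm
  omega

/-- The multiset of row lengths of a Young diagram. -/
def rows (μ : YoungDiagram) : Multiset ℕ := (μ.rowLens : Multiset ℕ)

lemma rows_injective : Function.Injective rows := by
  intro μ ν h
  have hl : μ.rowLens = ν.rowLens :=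
    (Multiset.coe_eq_coe.mp h).eq_of_pairwise'
      (μ.rowLens_sorted.pairwise) (ν.rowLens_sorted.pairwise)
  exact YoungDiagram.equivListRowLens.injective (Subtype.ext hl)

lemma rows_eq_map (μ : YoungDiagram) :
    rows μ = (Finset.range (μ.colLen 0)).val.map μ.rowLen := rfl

lemma pos_of_mem_rows {μ : YoungDiagram} {a : ℕ} (ha : a ∈ rows μ) : 0 < a :=
  μ.pos_of_mem_rowLens a ha

lemma rows_sum (μ : YoungDiagram) : (rows μ).sum = μ.card := by
  rw [rows_eq_map]
  change ∑ i ∈ Finset.range (μ.colLen 0), μ.rowLen i = μ.cells.card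
  rw [Finset.card_eq_sum_card_fiberwise (f := Prod.fst) (t := Finset.range (μ.colLen 0))]
  · exact Finset.sum_congr rfl fun i _ => μ.rowLen_eq_card
  · rintro ⟨i, j⟩ hij
    have : (i, 0) ∈ μ := μ.up_left_mem le_rfl (Nat.zero_le j) hij
    simpa using YoungDiagram.mem_iff_lt_colLen.mp this

lemma card_filter_rows (μ : YoungDiagram) (j : ℕ) :
    ((rows μ).filter fun a => j + 1 ≤ a).card = μ.colLen j := by
  rw [rows_eq_map, Multiset.filter_map, Multiset.card_map]
  change ((Finset.range (μ.colLen 0)).filter fun i => j + 1 ≤ μ.rowLen i).card = _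
  have : (Finset.range (μ.colLen 0)).filter (fun i => j + 1 ≤ μ.rowLen i) =
      Finset.range (μ.colLen j) := by
    ext i
    rw [Finset.mem_filter, Finset.mem_range, Finset.mem_range, Nat.succ_le_iff,
      ← YoungDiagram.mem_iff_lt_rowLen, ← YoungDiagram.mem_iff_lt_colLen,
      ← YoungDiagram.mem_iff_lt_colLen]
    exact ⟨And.right, fun h => ⟨μ.up_left_mem le_rfl (Nat.zero_le j) h, h⟩⟩
  rw [this, Finset.card_range]

lemma exists_rows_eq {M : Multiset ℕ} (hM : ∀ a ∈ M, 0 < a) : ∃ μ, rows μ = M := by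
  refine ⟨YoungDiagram.ofRowLens (M.sort (· ≥ ·)) (M.pairwise_sort (· ≥ ·)).sortedGE, ?_⟩
  rw [rows, YoungDiagram.rowLens_ofRowLens_eq_self, Multiset.sort_eq]
  exact fun a ha => hM a ((Multiset.mem_sort (· ≥ ·)).mp ha)

/-- Conjugation of partitions is transposition of Young diagrams. -/
lemma conjParts_eq_rows_transpose {n : ℕ} (P : n.Partition) {μ : YoungDiagram}
    (h : rows μ = P.parts) : conjParts P = rows μ.transpose := by
  have hcard : μ.card = n := by rw [← rows_sum, h, P.parts_sum]
  have hle := rowLen_zero_le_card μ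
  rw [hcard] at hle
  have hIcc : (Finset.Icc 1 n).val = (Finset.range n).val.map (· + 1) := by
    have : Finset.Icc 1 n = (Finset.range n).map ⟨(· + 1), add_left_injective 1⟩ := by
      ext j
      simp only [Finset.mem_Icc, Finset.mem_map, Finset.mem_range, Function.Embedding.coeFn_mk]
      exact ⟨fun hj => ⟨j - 1, by omega, by omega⟩, by rintro ⟨a, ha, rfl⟩; omega⟩
    rw [this]
    rfl
  have hfilter : (Finset.range n).filter (fun j => 0 < μ.colLen j) =
      Finset.range (μ.rowLen 0) := by
    ext j
    rw [Finset.mem_filter, Finset.mem_range, Finset.mem_range, ← YoungDiagram.mem_iff_lt_colLen,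
      YoungDiagram.mem_iff_lt_rowLen]
    omega
  rw [conjParts, ← h, hIcc, Multiset.map_map, rows_eq_map μ.transpose, YoungDiagram.colLen_transpose,
    ← hfilter]
  simp only [Function.comp_def, card_filter_rows, YoungDiagram.rowLen_transpose]
  rw [Multiset.filter_map]
  rfl

/-- The number of self-conjugate partitions, counted through their Young diagrams. -/
lemma s_eq_ncard (n : ℕ) : s n = {μ : YoungDiagram | μ.transpose = μ ∧ μ.card = n}.ncard := by
  rw [s, ← Nat.card_eq_fintype_card, ← Nat.card_coe_set_eq]
  refine (Nat.card_congr (Equiv.ofBijective (fun μ => ⟨⟨rows μ.1, pos_of_mem_rows,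
    (rows_sum μ.1).trans μ.2.2⟩,
    ((conjParts_eq_rows_transpose _ rfl).trans (congrArg rows μ.2.1)).symm⟩) ⟨?_, ?_⟩)).symm
  · intro μ ν h
    simp only [Subtype.mk.injEq, Nat.Partition.mk.injEq] at h
    exact Subtype.ext (rows_injective h)
  · rintro ⟨P, hP⟩
    obtain ⟨μ, hμ⟩ := exists_rows_eq (M := P.parts) (fun a ha => P.parts_pos ha)
    refine ⟨⟨μ, ?_, ?_⟩, ?_⟩
    · apply rows_injective
      rw [← conjParts_eq_rows_transpose P hμ, ← hP, hμ]
    · rw [← rows_sum, hμ, P.parts_sum]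
    · exact Subtype.ext (Nat.Partition.ext hμ)

lemma eventually_coeff_prod_odd (n : ℕ) : ∀ᶠ m in atTop,
    PowerSeries.coeff n (∏ k ∈ Finset.range m, (1 + PowerSeries.X ^ (2 * k + 1) :
      PowerSeries ℕ)) = s n := by
  filter_upwards [eventually_ge_atTop n] with m hm
  rw [← (ncard_selfConjDiagrams m n).2, selfConjDiagrams_of_le hm, s_eq_ncard]

/-- The generating function of self-conjugate partitions. -/
lemma hasSum_s {q : ℂ} (hq : ‖q‖ < 1) : HasSum (fun n : ℕ => (s n : ℂ) * q ^ n) (oddProd q) := by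
  refine hasSum_of_coeff_prod (φ := fun k q => 1 + q ^ (2 * k + 1)) (fun k => ?_)
    (fun q _ k => ?_) eventually_coeff_prod_odd
    (fun q hq => (multipliable_one_add_odd hq).hasProd) hq
  · simp
  · have h0 := hasSum_ite_eq 0 (1 : ℂ)
    have h1 := hasSum_ite_eq (2 * k + 1) (q ^ (2 * k + 1))
    convert! h0.add h1 using 2 with n
    rw [map_add, PowerSeries.coeff_one, PowerSeries.coeff_X_pow]
    push_cast
    rw [add_mul]
    congr 1
    · split_ifs with h <;> simp [h]
    · split_ifs with h <;> simp [h]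

lemma hasSum_exp_of_hasSum_pow {a : ℕ → ℕ} {Φ : ℂ → ℂ}
    (h : ∀ {q : ℂ}, ‖q‖ < 1 → HasSum (fun n : ℕ => (a n : ℂ) * q ^ n) (Φ q)) (z : ℂ)
    (hz : 0 < z.re) :
    HasSum (fun n : ℕ => (((a n : ℕ) : ℝ) : ℂ) * cexp (-(n * z))) (Φ (cexp (-z))) := by
  have h1 := h (norm_exp_neg_lt_one hz)
  simpa only [← Complex.exp_nat_mul, mul_neg, ofReal_natCast] using h1

/-- The Hardy–Ramanujan asymptotics of the partition function. -/
lemma tendsto_p : Tendsto (fun n : ℕ => (p n : ℝ) /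
      ((√(π ^ 2 / 6 / n)) ^ (1 / 2 + 3 / 2 : ℝ) * Real.exp (2 * √(π ^ 2 / 6 * n)))) atTop
    (𝓝 ((√(2 * π))⁻¹ * √(π / (π ^ 2 / 6)) / (2 * π))) := by
  refine tendsto_coeff (F := fun z => (eulerProd (cexp (-z)))⁻¹) (ε := 1 / 1280) (by positivity)
    (by norm_num) (by norm_num)
    (hasSum_exp_of_hasSum_pow (a := p) (Φ := fun q => (eulerProd q)⁻¹) hasSum_card_partition)
    ?_ far_inv_eulerProd
  have hC : (((√(2 * π))⁻¹ : ℝ) : ℂ) = ((2 * π : ℂ) ^ (1 / 2 : ℂ))⁻¹ := by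
    rw [ofReal_inv, Real.sqrt_eq_rpow, ofReal_cpow (by positivity)]
    push_cast
    rfl
  rw [hC]
  refine tendsto_inv_eulerProd.congr fun z => ?_
  push_cast
  rw [div_div]

/-- The asymptotics of the number of self-conjugate partitions. -/
lemma tendsto_s : Tendsto (fun n : ℕ => (s n : ℝ) /
      ((√(π ^ 2 / 24 / n)) ^ (0 + 3 / 2 : ℝ) * Real.exp (2 * √(π ^ 2 / 24 * n)))) atTop
    (𝓝 (1 * √(π / (π ^ 2 / 24)) / (2 * π))) :=
  tendsto_coeff (F := fun z => oddProd (cexp (-z))) (ε := 1 / 1280) (by positivity)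
    le_rfl (by norm_num) (hasSum_exp_of_hasSum_pow (a := s) hasSum_s) tendsto_oddProd far_oddProd

/-- Comparison of the two main terms. -/
lemma main_term_eq {n : ℕ} (hn : 0 < n) :
    (√(π ^ 2 / 24 / n)) ^ (0 + 3 / 2 : ℝ) * Real.exp (2 * √(π ^ 2 / 24 * n)) =
      (√(π ^ 2 / 6 / n)) ^ (1 / 2 + 3 / 2 : ℝ) * Real.exp (2 * √(π ^ 2 / 6 * n)) *
        ((6 * (n : ℝ)) ^ (1 / 4 : ℝ) * Real.exp (-(c / 2 * √n))) * (2 * √(2 * π))⁻¹ := by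
  have hn' : (0 : ℝ) < n := by exact_mod_cast hn
  have hπ := Real.pi_pos
  have hc : 2 * √(π ^ 2 / 6 * n) = c * √n := by
    rw [c, Real.sqrt_mul (by positivity)]
    ring
  have hc' : 2 * √(π ^ 2 / 24 * n) = c / 2 * √n := by
    rw [show π ^ 2 / 24 * n = (1 / 2) ^ 2 * (π ^ 2 / 6 * n) by ring,
      Real.sqrt_mul (by positivity), Real.sqrt_sq (by norm_num)]
    linarith
  set u := √(6 * n) with hu
  have hu0 : 0 < u := by positivity
  have husq : u ^ 2 = 6 * n := Real.sq_sqrt (by positivity)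
  have h1 : √(π ^ 2 / 6 / n) = π / u := by
    rw [div_div, ← husq, ← div_pow, Real.sqrt_sq (by positivity)]
  have h2 : √(π ^ 2 / 24 / n) = π / (2 * u) := by
    rw [div_div, show (24 * n : ℝ) = (2 * u) ^ 2 by rw [mul_pow, husq]; ring, ← div_pow,
      Real.sqrt_sq (by positivity)]
  have h3 : (6 * (n : ℝ)) ^ (1 / 4 : ℝ) = √u := by
    rw [← husq, Real.sqrt_eq_rpow, ← Real.rpow_natCast, ← Real.rpow_mul hu0.le]
    norm_num
  have h4 : (π / (2 * u)) ^ (0 + 3 / 2 : ℝ) = π / (2 * u) * (π / (√(2 * π) * √u)) := by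
    rw [show (0 + 3 / 2 : ℝ) = 1 + 1 / 2 by norm_num, Real.rpow_add (by positivity),
      Real.rpow_one, ← Real.sqrt_eq_rpow]
    congr 1
    rw [show π / (2 * u) = π ^ 2 / (2 * π * u) by field_simp, Real.sqrt_div (by positivity),
      Real.sqrt_sq hπ.le, Real.sqrt_mul (by positivity)]
  have h5 : (π / u) ^ (1 / 2 + 3 / 2 : ℝ) = (π / u) ^ 2 := by
    rw [← Real.rpow_natCast]
    norm_num
  have h6 : Real.exp (c / 2 * √n) = Real.exp (c * √n) * Real.exp (-(c / 2 * √n)) := by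
    rw [← Real.exp_add]
    ring_nf
  rw [h1, h2, h3, h4, h5, hc, hc', h6]
  have h7 : √u * √u = u := Real.mul_self_sqrt hu0.le
  have h8 : 0 < √u := by positivity
  have h9 : 0 < √(2 * π) := by positivity
  have key : π / (2 * u) * (π / (√(2 * π) * √u)) = (π / u) ^ 2 * √u * (2 * √(2 * π))⁻¹ := by
    generalize √(2 * π) = w at *
    field_simp
    rw [pow_two, h7]
  rw [key]
  ring

end SelfConjugate

end

open Filter

/-- `s n / p n ∼ (6n)^{1/4} e^{−(c/2)√n}` as `n → ∞`. -/
theorem selfConjugate_proportion :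
    Tendsto (fun n : ℕ =>
        ((s n : ℝ) / (p n : ℝ)) /
          ((6 * (n : ℝ)) ^ (1 / 4 : ℝ) * Real.exp (-(c / 2 * Real.sqrt n))))
      atTop (nhds 1) := by
  have hπ := Real.pi_pos
  have hp := SelfConjugate.tendsto_p
  have hK : (√(2 * Real.pi))⁻¹ * √(Real.pi / (Real.pi ^ 2 / 6)) / (2 * Real.pi) ≠ 0 := by
    positivity
  have h := (SelfConjugate.tendsto_s.div hp hK).mul_const (2 * √(2 * Real.pi))⁻¹
  have hlim : 1 * √(Real.pi / (Real.pi ^ 2 / 24)) / (2 * Real.pi) /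
      ((√(2 * Real.pi))⁻¹ * √(Real.pi / (Real.pi ^ 2 / 6)) / (2 * Real.pi)) *
      (2 * √(2 * Real.pi))⁻¹ = 1 := by
    rw [show Real.pi / (Real.pi ^ 2 / 24) = 2 ^ 2 * (Real.pi / (Real.pi ^ 2 / 6)) by
      field_simp; norm_num, Real.sqrt_mul (by positivity), Real.sqrt_sq (by norm_num)]
    have h1 : 0 < √(Real.pi / (Real.pi ^ 2 / 6)) := by positivity
    have h2 : 0 < √(2 * Real.pi) := by positivity
    generalize √(Real.pi / (Real.pi ^ 2 / 6)) = x at *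
    generalize √(2 * Real.pi) = y at *
    field_simp
  rw [hlim] at h
  refine h.congr' ?_
  filter_upwards [eventually_gt_atTop 0] with n hn
  have hn' : (0 : ℝ) < n := by exact_mod_cast hn
  simp only [Pi.div_apply]
  rw [SelfConjugate.main_term_eq hn]
  have h1 : 0 < (√(Real.pi ^ 2 / 6 / n)) ^ (1 / 2 + 3 / 2 : ℝ) *
      Real.exp (2 * √(Real.pi ^ 2 / 6 * n)) := by positivity
  have h2 : 0 < (6 * (n : ℝ)) ^ (1 / 4 : ℝ) * Real.exp (-(c / 2 * √n)) := by positivity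
  have h3 : 0 < √(2 * Real.pi) := by positivity
  generalize (√(Real.pi ^ 2 / 6 / n)) ^ (1 / 2 + 3 / 2 : ℝ) *
    Real.exp (2 * √(Real.pi ^ 2 / 6 * n)) = x at *
  generalize (6 * (n : ℝ)) ^ (1 / 4 : ℝ) * Real.exp (-(c / 2 * √n)) = y at *
  generalize √(2 * Real.pi) = w at *
  field_simp
end

section
/- For every natural number n, q(n) = Σ_r p((n − r(r+1)/2)/2), where the sum is over all non-negative integers r such that n − r(r+1)/2 is a non-negative even integer. -/
/-- `q n` is the number of partitions of `n` into distinct parts. -/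
def q (n : ℕ) : ℕ := (Nat.Partition.distincts n).card

open Finset PowerSeries PowerSeries.WithPiTopology

/-- Telescoping step in Shanks's proof of Gauss's triangular number identity. -/
lemma sum_range_shanks_sub {R : Type*} [CommRing R] (x : R) (P Q u : ℕ → R)
    (hu : ∀ n, u n * (1 - x ^ (2 * n + 1)) = 1)
    (hP : ∀ n, P (n + 1) = P n * (1 - x ^ (2 * n + 2)) * u n)
    (hQ : ∀ n, Q (n + 1) * (1 - x ^ (2 * n + 2)) = Q n * (1 - x ^ (2 * n + 1))) (n m : ℕ) :
    ∑ s ∈ range (m + 1),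
        (P (n + 1) * Q s * x ^ (s * (2 * n + 3)) - P n * Q s * x ^ (s * (2 * n + 1))) =
      P n * u n * x ^ ((m + 1) * (2 * n + 1)) * (1 - x ^ (2 * m + 1)) * Q m := by
  induction m with
  | zero =>
    simp only [zero_add, sum_range_one, hP]
    linear_combination (P n * Q 0) * hu n
  | succ m ih =>
    rw [sum_range_succ, ih, hP]
    linear_combination (-(P n * u n * x ^ ((m + 1) * (2 * n + 1)))) * hQ m
      + (P n * Q (m + 1) * x ^ ((m + 1) * (2 * n + 1))) * hu n

/-- Shanks's finite form of Gauss's triangular number identity. -/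
lemma sum_range_shanks {R : Type*} [CommRing R] (x : R) (P Q u : ℕ → R)
    (hu : ∀ n, u n * (1 - x ^ (2 * n + 1)) = 1)
    (hP : ∀ n, P (n + 1) = P n * (1 - x ^ (2 * n + 2)) * u n)
    (hQ : ∀ n, Q (n + 1) * (1 - x ^ (2 * n + 2)) = Q n * (1 - x ^ (2 * n + 1)))
    (hPQ : ∀ n, P n * Q n = 1) (n : ℕ) :
    ∑ s ∈ range (n + 1), P n * Q s * x ^ (s * (2 * n + 1)) =
      ∑ r ∈ range (2 * n + 1), x ^ (r * (r + 1) / 2) := by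
  induction n with
  | zero => simp [hPQ]
  | succ n ih =>
    have h := sum_range_shanks_sub x P Q u hu hP hQ n n
    rw [sum_sub_distrib, ih] at h
    have h₁ : (2 * n + 1) * (2 * n + 1 + 1) / 2 = (n + 1) * (2 * n + 1) := by
      rw [show (2 * n + 1) * (2 * n + 1 + 1) = 2 * ((n + 1) * (2 * n + 1)) by ring]
      simp
    have h₂ : (2 * n + 2) * (2 * n + 2 + 1) / 2 = (n + 1) * (2 * n + 3) := by
      rw [show (2 * n + 2) * (2 * n + 2 + 1) = 2 * ((n + 1) * (2 * n + 3)) by ring]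
      simp
    rw [sum_range_succ, show 2 * (n + 1) + 1 = 2 * n + 1 + 1 + 1 by ring,
      sum_range_succ _ (2 * n + 1 + 1), sum_range_succ _ (2 * n + 1), h₁, h₂]
    linear_combination h + x ^ ((n + 1) * (2 * n + 3)) * hPQ (n + 1)
      + P n * Q n * x ^ ((n + 1) * (2 * n + 1)) * hu n + x ^ ((n + 1) * (2 * n + 1)) * hPQ n

/-- Halving every part identifies partitions into even parts with all partitions of half the
size. -/
lemma card_restricted_even (k : ℕ) :
    #(Nat.Partition.restricted k (Even ·)) = if 2 ∣ k then p (k / 2) else 0 := by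
  split_ifs with hk
  · obtain ⟨m, rfl⟩ := hk
    rw [Nat.mul_div_cancel_left m two_pos, p, ← card_univ]
    symm
    refine card_bij (fun a _ => ⟨a.parts.map (2 * ·), ?_, ?_⟩) ?_ ?_ ?_
    · intro i hi
      obtain ⟨j, hj, rfl⟩ := Multiset.mem_map.1 hi
      have := a.parts_pos hj
      omega
    · rw [Multiset.sum_map_mul_left, Multiset.map_id', a.parts_sum]
    · intro a _
      simp [Nat.Partition.restricted]
    · intro a _ b _ h
      ext1
      exact Multiset.map_injective (mul_right_injective₀ two_ne_zero)
        (congrArg Nat.Partition.parts h)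
    · intro b hb
      have hb : ∀ i ∈ b.parts, Even i := by simpa [Nat.Partition.restricted] using hb
      have hmap : (b.parts.map (· / 2)).map (2 * ·) = b.parts := by
        rw [Multiset.map_map]
        conv_rhs => rw [← Multiset.map_id b.parts]
        exact Multiset.map_congr rfl fun i hi => Nat.two_mul_div_two_of_even (hb i hi)
      refine ⟨⟨b.parts.map (· / 2), ?_, ?_⟩, mem_univ _, Nat.Partition.ext hmap⟩
      · intro i hi
        obtain ⟨j, hj, rfl⟩ := Multiset.mem_map.1 hi
        have := b.parts_pos hj
        have := Nat.two_mul_div_two_of_even (hb j hj)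
        omega
      · have h := congrArg Multiset.sum hmap
        rw [Multiset.sum_map_mul_left, Multiset.map_id', b.parts_sum] at h
        omega
  · rw [card_eq_zero, Nat.Partition.restricted, filter_eq_empty_iff]
    intro a _ ha
    refine hk ?_
    rw [← a.parts_sum]
    exact Multiset.dvd_sum fun i hi => (ha i hi).two_dvd

lemma prod_range_two_mul_ite_odd {M : Type*} [CommMonoid M] (f : ℕ → M) (N : ℕ) :
    ∏ i ∈ range (2 * N), (if ¬ Even (i + 1) then f (i + 1) else 1) =
      ∏ i ∈ range N, f (2 * i + 1) := by
  induction N with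
  | zero => simp
  | succ N ih =>
    rw [show 2 * (N + 1) = 2 * N + 1 + 1 by ring, prod_range_succ, prod_range_succ, ih,
      prod_range_succ, if_pos (by simp), if_neg (by simp [Nat.even_add_one]),
      mul_one]

lemma prod_range_two_mul_ite_even {M : Type*} [CommMonoid M] (f : ℕ → M) (N : ℕ) :
    ∏ i ∈ range (2 * N), (if Even (i + 1) then f (i + 1) else 1) =
      ∏ i ∈ range N, f (2 * i + 2) := by
  induction N with
  | zero => simp
  | succ N ih =>
    rw [show 2 * (N + 1) = 2 * N + 1 + 1 by ring, prod_range_succ, prod_range_succ, ih,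
      prod_range_succ, if_neg (by simp), if_pos (by simp [Nat.even_add_one]),
      mul_one]

/-- If `a i` and `b i` invert `1 - X ^ (2 * i + 1)` and `1 - X ^ (2 * i + 2)`, then modulo
`X ^ (2 * N + 1)` the product of the first `N` of the `a i` is the product of the `b i` times
the sum of `X ^ (r * (r + 1) / 2)`. -/
lemma coeff_prod_odd_eq_sum (a b : ℕ → ℤ⟦X⟧)
    (ha : ∀ i, a i * (1 - X ^ (2 * i + 1)) = 1) (hb : ∀ i, b i * (1 - X ^ (2 * i + 2)) = 1)
    {n N : ℕ} (hn : n < 2 * N + 1) :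
    coeff n (∏ i ∈ range N, a i) = ∑ r ∈ range (2 * N + 1),
      if r * (r + 1) / 2 ≤ n then coeff (n - r * (r + 1) / 2) (∏ i ∈ range N, b i) else 0 := by
  set A : ℕ → ℤ⟦X⟧ := fun N => ∏ i ∈ range N, a i
  set B : ℕ → ℤ⟦X⟧ := fun N => ∏ i ∈ range N, b i
  set A' : ℕ → ℤ⟦X⟧ := fun N => ∏ i ∈ range N, (1 - X ^ (2 * i + 1))
  set B' : ℕ → ℤ⟦X⟧ := fun N => ∏ i ∈ range N, (1 - X ^ (2 * i + 2))
  have hA : ∀ N, A N * A' N = 1 := fun N => by simp [A, A', ← prod_mul_distrib, ha]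
  have hB : ∀ N, B N * B' N = 1 := fun N => by simp [B, B', ← prod_mul_distrib, hb]
  have key := sum_range_shanks (X : ℤ⟦X⟧) (fun N => A N * B' N) (fun N => A' N * B N) a ha
    (fun N => by simp only [A, B', prod_range_succ]; ring)
    (fun N => by
      simp only [A', B, prod_range_succ]
      linear_combination (∏ i ∈ range N, (1 - X ^ (2 * i + 1)) : ℤ⟦X⟧) *
        (1 - X ^ (2 * N + 1)) * (∏ i ∈ range N, b i) * hb N)
    (fun N => by linear_combination (B N * B' N) * hA N + hB N) N
  rw [sum_range_succ'] at key
  obtain ⟨S, hS⟩ : (X : ℤ⟦X⟧) ^ (2 * N + 1) ∣ ∑ s ∈ range N,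
      A N * B' N * (A' (s + 1) * B (s + 1)) * X ^ ((s + 1) * (2 * N + 1)) :=
    dvd_sum fun s _ => Dvd.dvd.mul_left (pow_dvd_pow _ (Nat.le_mul_of_pos_left _ s.succ_pos)) _
  have hA0 : A' 0 * B 0 = 1 := by simp [A', B]
  have hAN : A N = ∑ r ∈ range (2 * N + 1), X ^ (r * (r + 1) / 2) * B N -
      X ^ (2 * N + 1) * (S * B N) := by
    rw [← sum_mul, ← key, hS, hA0]
    linear_combination -(A N) * hB N
  change coeff n (A N) = _
  rw [hAN, map_sub, map_sum, coeff_X_pow_mul', if_neg (by omega), sub_zero]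
  exact sum_congr rfl fun r _ => coeff_X_pow_mul' _ _ _

/-- The coefficients of the finite products eventually count restricted partitions. -/
lemma eventually_coeff_prod_range_eq_card_restricted [TopologicalSpace ℤ] [DiscreteTopology ℤ]
    (P : ℕ → Prop) [DecidablePred P] (k : ℕ) :
    ∀ᶠ N in Filter.atTop, coeff k (∏ i ∈ range (2 * N),
      (if P (i + 1) then ∑' j : ℕ, (X : ℤ⟦X⟧) ^ ((i + 1) * j) else 1)) =
        #(Nat.Partition.restricted k P) := by
  have h := (Nat.Partition.hasProd_powerSeriesMk_card_restricted ℤ P).tendsto_prod_nat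
  have h := (tendsto_iff_coeff_tendsto _ _ _ _).1 h k
  rw [nhds_discrete, Filter.tendsto_pure] at h
  simpa using (Filter.tendsto_id.const_mul_atTop' two_pos).eventually h

/-- `q n = ∑_r p((n − r(r+1)/2)/2)`, the sum being over all non-negative integers `r` such
that `n − r(r+1)/2` is a non-negative even integer. -/
theorem distincts_count (n : ℕ) :
    q n = ∑ r ∈ (Finset.range (n + 1)).filter
        (fun r => r * (r + 1) / 2 ≤ n ∧ 2 ∣ (n - r * (r + 1) / 2)),
      p ((n - r * (r + 1) / 2) / 2) := by
  set g : ℕ → ℤ⟦X⟧ := fun k => ∑' j : ℕ, X ^ (k * j) with hg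
  have hg_mul : ∀ k, g (k + 1) * (1 - X ^ (k + 1)) = 1 := fun k => by
    simp only [hg, pow_mul]
    exact tsum_pow_mul_one_sub_of_constantCoeff_eq_zero (by simp)
  have hodd := eventually_coeff_prod_range_eq_card_restricted (¬ Even ·) n
  have heven : ∀ᶠ N in Filter.atTop, ∀ k ∈ range (n + 1), _ :=
    (Filter.eventually_all_finset _).2 fun k _ =>
      eventually_coeff_prod_range_eq_card_restricted (Even ·) k
  obtain ⟨N, hN, hN', hnN⟩ := (hodd.and (heven.and (Filter.eventually_ge_atTop n))).exists
  have key := coeff_prod_odd_eq_sum (fun i => g (2 * i + 1)) (fun i => g (2 * i + 2))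
    (fun i => hg_mul _) (fun i => hg_mul _) (n := n) (N := N) (by omega)
  rw [← prod_range_two_mul_ite_odd g, hN, ← prod_range_two_mul_ite_even g] at key
  have hle : ∀ r, r ≤ r * (r + 1) / 2 := fun r => by
    rw [Nat.le_div_iff_mul_le two_pos]
    rcases r with _ | r
    · simp
    · exact Nat.mul_le_mul_left _ (by omega)
  apply Nat.cast_injective (R := ℤ)
  rw [q, ← Nat.Partition.card_odds_eq_card_distincts, Nat.Partition.odds, key, sum_filter,
    Nat.cast_sum]
  symm
  refine sum_subset_zero_on_sdiff (range_subset_range.2 (by omega)) ?_ ?_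
  · intro r hr
    have := hle r
    rw [mem_sdiff, mem_range, mem_range] at hr
    exact if_neg (by omega)
  · intro r hr
    rw [hN' _ (mem_range.2 (by omega)), card_restricted_even]
    simp only [ite_and, Nat.cast_ite, Nat.cast_zero]
end
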